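/- arXiv:2603.10073 — 6 statements merged into one kernel-verified Lean document; each statement's English description precedes it below -/
import Mathlib

section
/- Fix c > 0, let δ_n = (1 + c²n)^{−1} and λ = c^{−2}. Let P_n = Binomial(n, δ_n), let Q_n be the law of S + B with S ~ Binomial(n−1, δ_n) and B ~ Bernoulli(1−δ_n) independent, let P_∞ = Poisson(λ), and let Q_∞ be the law of 1 + J with J ~ Poisson(λ). Then for every fixed ε ≥ 0 and every n ≥ 1, |δ_{Q_n‖P_n}(ε) − δ_{Q_∞‖P_∞}(ε)| ≤ (1 + e^ε)·(2/(c²n) + 2/(c⁴n)). In particular, δ_{Q_n‖P_n}(ε) → δ_{Q_∞‖P_∞}(ε) as n → ∞. -/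
open MeasureTheory Filter

/-- One-sided privacy curve `δ_{Q‖P}(ε) = sup_A (Q(A) - e^ε P(A))`. -/
noncomputable def privDelta {Ω : Type*} [MeasurableSpace Ω] (P Q : Measure Ω) (ε : ℝ) : ℝ :=
  ⨆ A : {s : Set Ω // MeasurableSet s}, ((Q A.1).toReal - Real.exp ε * (P A.1).toReal)

/-- Binomial(m,p) probability mass function on ℕ. -/
noncomputable def binomPMF (m : ℕ) (p : ℝ) (k : ℕ) : ℝ :=
  (m.choose k : ℝ) * p ^ k * (1 - p) ^ (m - k)

/-- Poisson(l) probability mass function on ℕ. -/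
noncomputable def poisPMF (l : ℝ) (k : ℕ) : ℝ :=
  Real.exp (-l) * l ^ k / (k.factorial : ℝ)

/-- Bernoulli(p) probability mass function on ℕ (mass `p` at 1, `1-p` at 0). -/
noncomputable def bernPMF (p : ℝ) (k : ℕ) : ℝ :=
  if k = 0 then 1 - p else if k = 1 then p else 0

/-- Convolution of two pmfs on ℕ: the pmf of the sum of independent variables. -/
noncomputable def convPMF (f g : ℕ → ℝ) (k : ℕ) : ℝ :=
  ∑ i ∈ Finset.range (k + 1), f i * g (k - i)

open ProbabilityTheory
open scoped ENNReal NNReal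

/-- `ν` exceeds `μ` by at most `t` on every set. -/
def DomBy (ν μ : Measure ℕ) (t : ℝ≥0∞) : Prop := ∀ A : Set ℕ, ν A ≤ μ A + t

lemma conv_apply_nat (μ ν : Measure ℕ) [SFinite ν] (A : Set ℕ) :
    (Measure.conv μ ν) A = ∫⁻ x, ν {y | x + y ∈ A} ∂μ := by
  have hA : MeasurableSet A := MeasurableSet.of_discrete
  rw [← lintegral_indicator_one hA, Measure.lintegral_conv (Measurable.of_discrete)]
  refine lintegral_congr fun x => ?_
  rw [← lintegral_indicator_one (MeasurableSet.of_discrete)]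
  rfl

lemma DomBy.conv {μ μ' ν ν' : Measure ℕ} [IsProbabilityMeasure μ] [IsProbabilityMeasure μ']
    [IsProbabilityMeasure ν] [IsProbabilityMeasure ν'] {s t : ℝ≥0∞}
    (h1 : DomBy μ μ' s) (h2 : DomBy ν ν' t) :
    DomBy (Measure.conv μ ν) (Measure.conv μ' ν') (s + t) := by
  intro A
  have e1 : (Measure.conv μ ν) A ≤ (Measure.conv μ ν') A + t := by
    rw [conv_apply_nat, conv_apply_nat]
    calc _ ≤ ∫⁻ x, (ν' {y | x + y ∈ A} + t) ∂μ := lintegral_mono fun x => h2 _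
      _ = _ := by rw [lintegral_add_right _ measurable_const]; simp
  have e2 : (Measure.conv ν' μ) A ≤ (Measure.conv ν' μ') A + s := by
    rw [conv_apply_nat, conv_apply_nat]
    calc _ ≤ ∫⁻ x, (μ' {y | x + y ∈ A} + s) ∂ν' := lintegral_mono fun x => h1 _
      _ = _ := by rw [lintegral_add_right _ measurable_const]; simp
  rw [Measure.conv_comm ν' μ, Measure.conv_comm ν' μ'] at e2
  calc _ ≤ _ := e1
    _ ≤ _ + s + t := by gcongr
    _ = _ := by rw [add_assoc]

lemma conv_singleton_nat {μ ν : Measure ℕ} [SFinite ν] {f g : ℕ → ℝ}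
    (hf : ∀ k, 0 ≤ f k) (hg : ∀ k, 0 ≤ g k)
    (h1 : ∀ k, μ {k} = ENNReal.ofReal (f k)) (h2 : ∀ k, ν {k} = ENNReal.ofReal (g k)) (k : ℕ) :
    (Measure.conv μ ν) {k} = ENNReal.ofReal (convPMF f g k) := by
  rw [conv_apply_nat, lintegral_countable', tsum_eq_sum (s := Finset.range (k + 1)), convPMF,
    ENNReal.ofReal_sum_of_nonneg (fun i _ => mul_nonneg (hf _) (hg _))]
  · refine Finset.sum_congr rfl fun i hi => ?_
    have hi' : i ≤ k := by simpa [Nat.lt_succ_iff] using hi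
    have : {y | i + y ∈ ({k} : Set ℕ)} = {k - i} := by
      ext y; simp only [Set.mem_ofPred_eq, Set.mem_singleton_iff]; omega
    rw [this, h1, h2, ENNReal.ofReal_mul (hf _), mul_comm]
  · intro i hi
    have hi' : k < i := by simpa using hi
    have : {y | i + y ∈ ({k} : Set ℕ)} = ∅ := by
      ext y; simp; omega
    rw [this]; simp

lemma convPMF_bern_zero (f : ℕ → ℝ) (q : ℝ) : convPMF f (bernPMF q) 0 = f 0 * (1 - q) := by
  simp [convPMF, bernPMF]

lemma convPMF_bern_succ (f : ℕ → ℝ) (q : ℝ) (k : ℕ) :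
    convPMF f (bernPMF q) (k + 1) = f k * q + f (k + 1) * (1 - q) := by
  rw [convPMF, Finset.sum_range_succ, Finset.sum_range_succ, Finset.sum_eq_zero]
  · simp [bernPMF]
  · intro i hi
    have hi' : i < k := by simpa using hi
    have a1 : k + 1 - i ≠ 0 := by omega
    have a2 : k + 1 - i ≠ 1 := by omega
    rw [bernPMF, if_neg a1, if_neg a2, mul_zero]

lemma binomPMF_succ (n : ℕ) (p : ℝ) :
    convPMF (binomPMF n p) (bernPMF p) = binomPMF (n + 1) p := by
  funext k
  cases k with
  | zero => rw [convPMF_bern_zero]; simp [binomPMF, pow_succ]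
  | succ k =>
    rw [convPMF_bern_succ]
    simp only [binomPMF, Nat.choose_succ_succ, Nat.cast_add, Nat.succ_eq_add_one]
    rcases lt_trichotomy k n with h | h | h
    · obtain ⟨m, rfl⟩ : ∃ m, n = k + 1 + m := ⟨n - (k + 1), by omega⟩
      have a1 : k + 1 + m - k = m + 1 := by omega
      have a2 : k + 1 + m - (k + 1) = m := by omega
      have a3 : k + 1 + m + 1 - (k + 1) = m + 1 := by omega
      rw [a1, a2, a3]; ring
    · subst h; simp; ring
    · simp [Nat.choose_eq_zero_of_lt h, Nat.choose_eq_zero_of_lt (Nat.lt_succ_of_lt h)]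

/-- Bernoulli measure. -/
noncomputable def bernM (q : ℝ) : Measure ℕ :=
  ENNReal.ofReal (1 - q) • Measure.dirac 0 + ENNReal.ofReal q • Measure.dirac 1

lemma bernM_prob {q : ℝ} (h0 : 0 ≤ q) (h1 : q ≤ 1) : IsProbabilityMeasure (bernM q) := by
  constructor
  simp only [bernM, Measure.add_apply, Measure.smul_apply, measure_univ, smul_eq_mul, mul_one]
  rw [← ENNReal.ofReal_add (by linarith) h0]; simp

lemma bernM_singleton (q : ℝ) (k : ℕ) : bernM q {k} = ENNReal.ofReal (bernPMF q k) := by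
  rcases k with _ | _ | k <;> simp [bernM, bernPMF]

lemma bernPMF_nonneg {q : ℝ} (h0 : 0 ≤ q) (h1 : q ≤ 1) (k : ℕ) : 0 ≤ bernPMF q k := by
  unfold bernPMF; split_ifs <;> linarith

lemma binomPMF_nonneg {q : ℝ} (h0 : 0 ≤ q) (h1 : q ≤ 1) (n k : ℕ) : 0 ≤ binomPMF n q k := by
  have : 0 ≤ 1 - q := by linarith
  unfold binomPMF; positivity

lemma domBy_of_two (ν μ : Measure ℕ) [IsProbabilityMeasure ν] (h0 : ν {0} ≤ μ {0})
    (h1 : ν {1} ≤ μ {1}) {x y t : ℝ} (hx : 0 ≤ x) (hy : 0 ≤ y) (h0' : ν {0} = ENNReal.ofReal x)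
    (h1' : ν {1} = ENNReal.ofReal y) (ht : 1 - (x + y) ≤ t) :
    DomBy ν μ (ENNReal.ofReal t) := by
  intro A
  have e0 : ν.restrict ({0, 1} : Set ℕ) ≤ μ := by
    refine Measure.le_iff.2 fun s _ => ?_
    rw [Measure.restrict_apply MeasurableSet.of_discrete]
    have key : ∀ ρ : Measure ℕ, ρ (s ∩ {0, 1}) = ρ (s ∩ {0}) + ρ (s ∩ {1}) := by
      intro ρ
      rw [← measure_union _ MeasurableSet.of_discrete]
      · congr 1; ext z; simp; tauto
      · rw [Set.disjoint_left]; intro z hz hz'; simp at hz hz'; omega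
    refine le_trans ?_ (measure_mono (Set.inter_subset_left (t := {0, 1})))
    rw [key, key]
    have one : ∀ j : ℕ, ν {j} ≤ μ {j} → ν (s ∩ {j}) ≤ μ (s ∩ {j}) := by
      intro j hj
      by_cases hs : j ∈ s
      · rwa [Set.inter_eq_right.2 (by simpa using hs)]
      · rw [Set.inter_singleton_eq_empty.2 hs]; simp
    exact add_le_add (one 0 h0) (one 1 h1)
  have e1 : ν ({0, 1} : Set ℕ)ᶜ ≤ ENNReal.ofReal t := by
    have : ν ({0, 1} : Set ℕ) = ENNReal.ofReal (x + y) := by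
      rw [ENNReal.ofReal_add hx hy, ← h0', ← h1', ← measure_union _ MeasurableSet.of_discrete]
      · rfl
      · simp
    rw [prob_compl_eq_one_sub MeasurableSet.of_discrete, this, ← ENNReal.ofReal_one,
      ← ENNReal.ofReal_sub _ (by positivity)]
    exact ENNReal.ofReal_le_ofReal ht
  calc ν A ≤ ν (A ∩ {0, 1}) + ν (A \ {0, 1}) := (measure_inter_add_sdiff A
        MeasurableSet.of_discrete).ge
    _ ≤ μ A + ENNReal.ofReal t := by
        refine add_le_add ?_ ((measure_mono fun z hz => hz.2).trans e1)
        rw [← Measure.restrict_apply MeasurableSet.of_discrete]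
        exact e0 A

lemma DomBy.abs_le {ν μ : Measure ℕ} [IsProbabilityMeasure ν] [IsProbabilityMeasure μ] {t : ℝ}
    (ht : 0 ≤ t) (h : DomBy ν μ (ENNReal.ofReal t)) (A : Set ℕ) :
    |(μ A).toReal - (ν A).toReal| ≤ t := by
  have key : ∀ B : Set ℕ, ν.real B ≤ μ.real B + t := by
    intro B
    have := ENNReal.toReal_mono (by finiteness) (h B)
    rwa [ENNReal.toReal_add (by finiteness) (by finiteness), ENNReal.toReal_ofReal ht] at this
  have k1 := key A
  have k2 := key Aᶜ
  rw [probReal_compl_eq_one_sub MeasurableSet.of_discrete,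
    probReal_compl_eq_one_sub MeasurableSet.of_discrete] at k2
  change |μ.real A - ν.real A| ≤ t
  rw [_root_.abs_le]; constructor <;> linarith

lemma privDelta_le {P Q P' Q' : Measure ℕ} [IsProbabilityMeasure P'] [IsProbabilityMeasure Q']
    {ε s t : ℝ} (hQ : ∀ A, |(Q A).toReal - (Q' A).toReal| ≤ s)
    (hP : ∀ A, |(P A).toReal - (P' A).toReal| ≤ t) :
    privDelta P Q ε ≤ privDelta P' Q' ε + (s + Real.exp ε * t) := by
  have : Nonempty {s : Set ℕ // MeasurableSet s} := ⟨⟨∅, MeasurableSet.empty⟩⟩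
  refine ciSup_le fun A => ?_
  have hb : BddAbove (Set.range fun A : {s : Set ℕ // MeasurableSet s} =>
      ((Q' A.1).toReal - Real.exp ε * (P' A.1).toReal)) := by
    refine ⟨1, ?_⟩
    rintro _ ⟨B, rfl⟩
    have h1 : (Q' B.1).toReal ≤ 1 := measureReal_le_one (μ := Q')
    have h2 : 0 ≤ Real.exp ε * (P' B.1).toReal := by positivity
    simp only; linarith
  have h := le_ciSup hb A
  have h1 := (abs_le.1 (hQ A.1)).2
  have h2 := (abs_le.1 (hP A.1)).1
  have h3 := mul_le_mul_of_nonneg_left h2 (Real.exp_pos ε).le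
  unfold privDelta
  linarith

lemma privDelta_abs_le {P Q P' Q' : Measure ℕ} [IsProbabilityMeasure P] [IsProbabilityMeasure Q]
    [IsProbabilityMeasure P'] [IsProbabilityMeasure Q']
    {ε s t : ℝ} (hQ : ∀ A, |(Q A).toReal - (Q' A).toReal| ≤ s)
    (hP : ∀ A, |(P A).toReal - (P' A).toReal| ≤ t) :
    |privDelta P Q ε - privDelta P' Q' ε| ≤ s + Real.exp ε * t := by
  have h1 := privDelta_le (ε := ε) hQ hP
  have h2 := privDelta_le (P := P') (Q := Q') (P' := P) (Q' := Q) (ε := ε) (s := s) (t := t)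
    (fun A => by rw [abs_sub_comm]; exact hQ A) (fun A => by rw [abs_sub_comm]; exact hP A)
  rw [abs_le]; constructor <;> linarith

lemma exp_facts (a : ℝ) (ha : 0 ≤ a) : Real.exp (-a) ≤ (1 + a)⁻¹ ∧ 1 - a ≤ Real.exp (-a) := by
  constructor
  · rw [Real.exp_neg]
    apply inv_anti₀ (by positivity)
    linarith [Real.add_one_le_exp a]
  · linarith [Real.add_one_le_exp (-a)]

lemma binom_pois (a : ℝ≥0) (p : ℝ) (hp : 1 - p = (1 + (a : ℝ))⁻¹) (n : ℕ) :
    ∃ μ : Measure ℕ, IsProbabilityMeasure μ ∧ (∀ k, μ {k} = ENNReal.ofReal (binomPMF n p k)) ∧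
      DomBy (poissonMeasure (n * a)) μ (ENNReal.ofReal (n * (a : ℝ) ^ 2)) := by
  have ha : (0 : ℝ) ≤ a := a.2
  have hi : (1 + (a : ℝ))⁻¹ ≤ 1 := inv_le_one_of_one_le₀ (by linarith)
  have hi0 : 0 < (1 + (a : ℝ))⁻¹ := by positivity
  have h0 : 0 ≤ p := by linarith
  have h1 : p ≤ 1 := by linarith
  have hpa : p = a * (1 + (a : ℝ))⁻¹ := by
    have : p = 1 - (1 + (a : ℝ))⁻¹ := by linarith
    rw [this]; field_simp; ring
  obtain ⟨e1, e2⟩ := exp_facts a ha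
  have hB := bernM_prob h0 h1
  have hone : DomBy (poissonMeasure a) (bernM p) (ENNReal.ofReal ((a : ℝ) ^ 2)) := by
    refine domBy_of_two _ _ ?_ ?_ (x := Real.exp (-a)) (y := Real.exp (-a) * a) (by positivity)
      (by positivity) ?_ ?_ ?_
    · rw [poissonMeasure_singleton, bernM_singleton]
      apply ENNReal.ofReal_le_ofReal
      simp only [bernPMF]; simp; linarith
    · rw [poissonMeasure_singleton, bernM_singleton]
      apply ENNReal.ofReal_le_ofReal
      simp only [bernPMF]; simp
      rw [hpa]; nlinarith
    · rw [poissonMeasure_singleton]; simp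
    · rw [poissonMeasure_singleton]; simp
    · nlinarith
  induction n with
  | zero =>
    refine ⟨Measure.dirac 0, inferInstance, ?_, ?_⟩
    · intro k
      rcases k with _ | k <;> simp [binomPMF]
    · have : poissonMeasure (((0 : ℕ) : ℝ≥0) * a) = Measure.dirac 0 := by
        refine Measure.ext_of_singleton fun k => ?_
        rw [poissonMeasure_singleton]
        rcases k with _ | k <;> simp
      rw [this]; intro A; simp
  | succ n ih =>
    obtain ⟨μ, hμ, hs, hd⟩ := ih
    refine ⟨Measure.conv μ (bernM p), inferInstance, ?_, ?_⟩
    · intro k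
      rw [conv_singleton_nat (binomPMF_nonneg h0 h1 n) (bernPMF_nonneg h0 h1) hs
        (bernM_singleton p), binomPMF_succ]
    · have := hd.conv hone
      rw [poissonMeasure_conv_poissonMeasure, ← ENNReal.ofReal_add (by positivity)
        (by positivity)] at this
      convert this using 2 <;> push_cast <;> ring

lemma shift_dom (a : ℝ≥0) (p : ℝ) (hp : 1 - p = (1 + (a : ℝ))⁻¹) :
    DomBy (Measure.conv (Measure.dirac 1) (poissonMeasure a)) (bernM (1 - p))
      (ENNReal.ofReal a) := by
  have ha : (0 : ℝ) ≤ a := a.2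
  obtain ⟨e1, e2⟩ := exp_facts a ha
  have s0 : (Measure.conv (Measure.dirac 1) (poissonMeasure a)) {0} = 0 := by
    rw [conv_apply_nat, lintegral_dirac]; simp
  have s1 : (Measure.conv (Measure.dirac 1) (poissonMeasure a)) {1}
      = ENNReal.ofReal (Real.exp (-a)) := by
    rw [conv_apply_nat, lintegral_dirac]
    have : {y : ℕ | 1 + y ∈ ({1} : Set ℕ)} = {0} := by ext; simp
    rw [this, poissonMeasure_singleton]; simp
  refine domBy_of_two _ _ ?_ ?_ (x := 0) (y := Real.exp (-a)) le_rfl (by positivity) ?_ s1 ?_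
  · rw [s0]; simp
  · rw [s1, bernM_singleton]
    apply ENNReal.ofReal_le_ofReal
    simp only [bernPMF]; simp; linarith
  · rw [s0]; simp
  · linarith

/-- Privacy curve convergence for the Poisson-shift limit in the canonical calibration
`δ_n = (1+c²n)⁻¹`, `λ = c⁻²`: quantitative bound
`|δ_{Q_n‖P_n}(ε) - δ_{Q_∞‖P_∞}(ε)| ≤ (1+e^ε)(2/(c²n) + 2/(c⁴n))` and pointwise convergence. -/
theorem stmt3 (c : ℝ) (hc : 0 < c)
    (Pn Qn : ℕ → Measure ℕ) (Pinf Qinf : Measure ℕ)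
    [∀ n, IsProbabilityMeasure (Pn n)] [∀ n, IsProbabilityMeasure (Qn n)]
    [IsProbabilityMeasure Pinf] [IsProbabilityMeasure Qinf]
    (hPn : ∀ n k, Pn n {k} = ENNReal.ofReal (binomPMF n ((1 + c ^ 2 * n)⁻¹) k))
    (hQn : ∀ n k, Qn n {k} = ENNReal.ofReal
      (convPMF (binomPMF (n - 1) ((1 + c ^ 2 * n)⁻¹)) (bernPMF (1 - (1 + c ^ 2 * n)⁻¹)) k))
    (hPinf : ∀ k, Pinf {k} = ENNReal.ofReal (poisPMF (c ^ 2)⁻¹ k))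
    (hQinf : ∀ k, Qinf {k} = ENNReal.ofReal (if k = 0 then 0 else poisPMF (c ^ 2)⁻¹ (k - 1)))
    (ε : ℝ) (hε : 0 ≤ ε) :
    (∀ n : ℕ, 1 ≤ n →
      |privDelta (Pn n) (Qn n) ε - privDelta Pinf Qinf ε|
        ≤ (1 + Real.exp ε) * (2 / (c ^ 2 * n) + 2 / (c ^ 4 * n)))
    ∧ Tendsto (fun n => privDelta (Pn n) (Qn n) ε) atTop (nhds (privDelta Pinf Qinf ε)) := by
  have main : ∀ n : ℕ, 1 ≤ n →
      |privDelta (Pn n) (Qn n) ε - privDelta Pinf Qinf ε|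
        ≤ (1 + Real.exp ε) * (2 / (c ^ 2 * n) + 2 / (c ^ 4 * n)) := by
    intro n hn
    have hn0 : (0 : ℝ) < n := by exact_mod_cast hn
    have hc2 : 0 < c ^ 2 := by positivity
    let a : ℝ≥0 := ⟨(c ^ 2 * n)⁻¹, by positivity⟩
    have haR : (a : ℝ) = (c ^ 2 * n)⁻¹ := rfl
    have ha0 : (0 : ℝ) ≤ a := a.2
    set p : ℝ := (1 + c ^ 2 * n)⁻¹ with hpdef
    have hp : 1 - p = (1 + (a : ℝ))⁻¹ := by
      rw [haR, hpdef]; field_simp; ring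
    have hp0 : 0 ≤ p := by positivity
    have hp1 : p ≤ 1 := by
      have : 0 ≤ 1 - p := by rw [hp]; positivity
      linarith
    have hna : ((n * a : ℝ≥0) : ℝ) = (c ^ 2)⁻¹ := by
      push_cast; rw [haR]; field_simp
    have hPinf' : Pinf = poissonMeasure (n * a) := by
      refine Measure.ext_of_singleton fun k => ?_
      rw [hPinf, poissonMeasure_singleton, hna, poisPMF]
    have hQinf' : Qinf = Measure.conv (Measure.dirac 1) (poissonMeasure (n * a)) := by
      refine Measure.ext_of_singleton fun k => ?_
      rw [hQinf, conv_apply_nat, lintegral_dirac]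
      rcases k with _ | k
      · simp
      · have : {y : ℕ | 1 + y ∈ ({k + 1} : Set ℕ)} = {k} := by
          ext; simp; omega
        rw [this, poissonMeasure_singleton, hna]
        simp [poisPMF]
    -- the binomial part
    have hPd : DomBy Pinf (Pn n) (ENNReal.ofReal (n * (a : ℝ) ^ 2)) := by
      obtain ⟨μ, hμ, hs, hd⟩ := binom_pois a p hp n
      have : Pn n = μ := Measure.ext_of_singleton fun k => by rw [hPn, hs]
      rw [this, hPinf']; exact hd
    have hQd : DomBy Qinf (Qn n) (ENNReal.ofReal (n * (a : ℝ) ^ 2 + a)) := by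
      obtain ⟨m, rfl⟩ : ∃ m, n = m + 1 := ⟨n - 1, by omega⟩
      obtain ⟨μ, hμ, hs, hd⟩ := binom_pois a p hp m
      have hB := bernM_prob (q := 1 - p) (by linarith) (by linarith)
      have e1 : Qn (m + 1) = Measure.conv μ (bernM (1 - p)) := by
        refine Measure.ext_of_singleton fun k => ?_
        rw [hQn, conv_singleton_nat (binomPMF_nonneg hp0 hp1 m)
          (bernPMF_nonneg (q := 1 - p) (by linarith) (by linarith)) hs (bernM_singleton _)]
        rfl
      have e2 : Qinf = Measure.conv (poissonMeasure (m * a))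
          (Measure.conv (Measure.dirac 1) (poissonMeasure a)) := by
        rw [hQinf', ← Measure.conv_assoc, Measure.conv_comm (poissonMeasure (m * a)),
          Measure.conv_assoc, poissonMeasure_conv_poissonMeasure]
        congr 2; push_cast; ring
      have h := hd.conv (shift_dom a p hp)
      rw [← e1, ← e2, ← ENNReal.ofReal_add (by positivity) ha0] at h
      intro A
      refine (h A).trans ?_
      gcongr
      simp
    have hP := fun A => hPd.abs_le (by positivity) A
    have hQ := fun A => hQd.abs_le (by positivity) A
    refine (privDelta_abs_le (ε := ε) hQ hP).trans ?_
    have h1 : (n : ℝ) * (a : ℝ) ^ 2 = 1 / (c ^ 4 * n) := by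
      rw [haR]; field_simp
    have h2 : (a : ℝ) = 1 / (c ^ 2 * n) := by rw [haR]; simp
    have h3 : 2 / (c ^ 2 * n) = 2 * (a : ℝ) := by rw [h2]; ring
    have h4 : 2 / (c ^ 4 * n) = 2 * ((n : ℝ) * (a : ℝ) ^ 2) := by rw [h1]; ring
    rw [h3, h4]
    have h5 : 0 ≤ (n : ℝ) * (a : ℝ) ^ 2 := by positivity
    have he := Real.exp_pos ε
    nlinarith [mul_nonneg he.le h5, mul_nonneg he.le ha0]
  refine ⟨main, ?_⟩
  rw [tendsto_iff_norm_sub_tendsto_zero]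
  have hlim : Tendsto (fun n : ℕ => (1 + Real.exp ε) * (2 / (c ^ 2 * n) + 2 / (c ^ 4 * n)))
      atTop (nhds 0) := by
    have h : Tendsto (fun n : ℕ => ((1 + Real.exp ε) * (2 / c ^ 2 + 2 / c ^ 4)) / (n : ℝ))
        atTop (nhds 0) := tendsto_const_div_atTop_nhds_zero_nat _
    refine h.congr fun n => ?_
    rw [mul_div_assoc, add_div, div_div, div_div]
  refine tendsto_of_tendsto_of_tendsto_of_le_of_le' tendsto_const_nhds hlim
    (Eventually.of_forall fun n => norm_nonneg _) ?_
  filter_upwards [eventually_ge_atTop 1] with n hn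
  rw [Real.norm_eq_abs]
  exact main n hn
end

section
/- Fix c > 0, let δ_n = (1 + c²n)^{−1}, P_n = Binomial(n, δ_n), and P_∞ = Poisson(1/c²). Then there exists N such that for all n ≥ N, (e^{−1/c²}/(4c⁴))·(1/n) ≤ TV(P_n, P_∞) ≤ (2/c⁴)·(1/n). In particular TV(P_n, P_∞) = Θ(n^{−1}). Moreover, the atom at zero satisfies P_n{0} − P_∞{0} = (e^{−1/c²}/(2c⁴))·(1/n) + O(n^{−2}). -/
open MeasureTheory Filter

/-- Total variation distance `TV(μ,ν) = sup_A |μ(A) - ν(A)|`. -/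
noncomputable def tvDist {Ω : Type*} [MeasurableSpace Ω] (μ ν : Measure Ω) : ℝ :=
  ⨆ A : {s : Set Ω // MeasurableSet s}, |(μ A.1).toReal - (ν A.1).toReal|

theorem aux_log_lower (s : ℝ) (hs : 0 ≤ s) : s - s ^ 2 / 2 ≤ Real.log (1 + s) := by
  have hd : ∀ x : ℝ, 0 ≤ x → HasDerivAt (fun x : ℝ => Real.log (1 + x) - (x - x ^ 2 / 2))
      (1 / (1 + x) - (1 - (2 * x) / 2)) x := by
    intro x hx
    have h1 : HasDerivAt (fun x : ℝ => 1 + x) 1 x := (hasDerivAt_id x).const_add 1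
    have h2 := h1.log (by positivity)
    have h3 : HasDerivAt (fun x : ℝ => x ^ 2) (2 * x) x := by
      simpa using hasDerivAt_pow 2 x
    exact h2.sub ((hasDerivAt_id x).sub (h3.div_const 2))
  have hm : MonotoneOn (fun x : ℝ => Real.log (1 + x) - (x - x ^ 2 / 2)) (Set.Ici 0) := by
    refine monotoneOn_of_deriv_nonneg (convex_Ici 0)
      (fun x hx => (hd x hx).continuousAt.continuousWithinAt)
      (fun x hx => ?_) (fun x hx => ?_)
    · rw [interior_Ici] at hx
      exact (hd x (le_of_lt hx)).differentiableAt.differentiableWithinAt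
    · rw [interior_Ici] at hx
      have hxp : 0 < x := hx
      rw [(hd x hxp.le).deriv]
      have : 1 / (1 + x) - (1 - (2 * x) / 2) = x ^ 2 / (1 + x) := by field_simp; ring
      rw [this]; positivity
  have := hm (Set.mem_Ici.2 le_rfl) (Set.mem_Ici.2 hs) hs
  simp at this
  linarith

theorem aux_log_upper (s : ℝ) (hs : 0 ≤ s) :
    Real.log (1 + s) ≤ s - s ^ 2 / 2 + s ^ 3 / 3 := by
  have hd : ∀ x : ℝ, 0 ≤ x →
      HasDerivAt (fun x : ℝ => (x - x ^ 2 / 2 + x ^ 3 / 3) - Real.log (1 + x))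
      ((1 - (2 * x) / 2 + (3 * x ^ 2) / 3) - 1 / (1 + x)) x := by
    intro x hx
    have h1 : HasDerivAt (fun x : ℝ => 1 + x) 1 x := (hasDerivAt_id x).const_add 1
    have h2 := h1.log (by positivity)
    have h3 : HasDerivAt (fun x : ℝ => x ^ 2) (2 * x) x := by
      simpa using hasDerivAt_pow 2 x
    have h4 : HasDerivAt (fun x : ℝ => x ^ 3) (3 * x ^ 2) x := by
      simpa using hasDerivAt_pow 3 x
    exact (((hasDerivAt_id x).sub (h3.div_const 2)).add (h4.div_const 3)).sub h2
  have hm : MonotoneOn (fun x : ℝ => (x - x ^ 2 / 2 + x ^ 3 / 3) - Real.log (1 + x))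
      (Set.Ici 0) := by
    refine monotoneOn_of_deriv_nonneg (convex_Ici 0)
      (fun x hx => (hd x hx).continuousAt.continuousWithinAt)
      (fun x hx => ?_) (fun x hx => ?_)
    · rw [interior_Ici] at hx
      exact (hd x (le_of_lt hx)).differentiableAt.differentiableWithinAt
    · rw [interior_Ici] at hx
      have hxp : 0 < x := hx
      rw [(hd x hxp.le).deriv]
      have : (1 - (2 * x) / 2 + (3 * x ^ 2) / 3) - 1 / (1 + x) = x ^ 3 / (1 + x) := by
        field_simp; ring
      rw [this]; positivity
  have := hm (Set.mem_Ici.2 le_rfl) (Set.mem_Ici.2 hs) hs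
  simp at this
  linarith

theorem aux_exp (x : ℝ) (hx : 0 ≤ x) : Real.exp x - 1 - x ≤ x ^ 2 * Real.exp x := by
  have h1 : Real.exp x - 1 ≤ x * Real.exp x := by
    have h := Real.add_one_le_exp (-x)
    have h2 := mul_le_mul_of_nonneg_right h (Real.exp_pos x).le
    rw [← Real.exp_add] at h2
    simp at h2
    linarith
  nlinarith [mul_le_mul_of_nonneg_left h1 hx]

/-- exponent: log of the likelihood ratio at zero -/
noncomputable def auxX (l : ℝ) (n : ℕ) : ℝ := n * (l / n - Real.log (1 + l / n))

theorem auxX_bounds (l : ℝ) (hl : 0 < l) (n : ℕ) (hn : 1 ≤ n) :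
    l ^ 2 / (2 * n) - l ^ 3 / (3 * n ^ 2) ≤ auxX l n ∧ auxX l n ≤ l ^ 2 / (2 * n) := by
  have hn0 : (0 : ℝ) < n := by exact_mod_cast hn
  have h1 := aux_log_lower (l / n) (by positivity)
  have h2 := aux_log_upper (l / n) (by positivity)
  unfold auxX
  constructor
  · have : l ^ 2 / (2 * n) - l ^ 3 / (3 * n ^ 2)
        = n * ((l / n) ^ 2 / 2 - (l / n) ^ 3 / 3) := by field_simp
    rw [this]
    apply mul_le_mul_of_nonneg_left _ hn0.le
    linarith
  · have : l ^ 2 / (2 * n) = n * ((l / n) ^ 2 / 2) := by field_simp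
    rw [this]
    apply mul_le_mul_of_nonneg_left _ hn0.le
    linarith

theorem auxX_nonneg (l : ℝ) (hl : 0 < l) (n : ℕ) : 0 ≤ auxX l n := by
  unfold auxX
  have : (0 : ℝ) ≤ l / n := by positivity
  have := Real.log_le_sub_one_of_pos (x := 1 + l / n) (by positivity)
  apply mul_nonneg (by positivity); linarith

theorem aux_pow (l : ℝ) (hl : 0 < l) (n : ℕ) (hn : 1 ≤ n) :
    (1 / (1 + l / n)) ^ n = Real.exp (-l) * Real.exp (auxX l n) := by
  have hn0 : (0 : ℝ) < n := by exact_mod_cast hn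
  have hp : (0 : ℝ) < 1 + l / n := by positivity
  rw [← Real.exp_add]
  have : -l + auxX l n = n * (- Real.log (1 + l / n)) := by
    unfold auxX; field_simp; ring
  rw [this, Real.exp_nat_mul, Real.exp_neg, Real.exp_log hp, one_div]

theorem aux_param (c : ℝ) (hc : 0 < c) (n : ℕ) (hn : 1 ≤ n) :
    1 - (1 + c ^ 2 * n)⁻¹ = 1 / (1 + (c ^ 2)⁻¹ / n) ∧
    (1 + c ^ 2 * n)⁻¹ = ((c ^ 2)⁻¹ / n) * (1 / (1 + (c ^ 2)⁻¹ / n)) := by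
  have hn0 : (0 : ℝ) < n := by exact_mod_cast hn
  have h : 1 + c ^ 2 * n ≠ 0 := by positivity
  have hb : 1 + (c ^ 2)⁻¹ / n = (1 + c ^ 2 * n) / (c ^ 2 * n) := by field_simp; ring
  rw [hb]
  constructor
  · field_simp; ring
  · field_simp

theorem aux_zero (c : ℝ) (hc : 0 < c) (n : ℕ) (hn : 1 ≤ n) :
    binomPMF n ((1 + c ^ 2 * n)⁻¹) 0 =
      Real.exp (-(c ^ 2)⁻¹) * Real.exp (auxX (c ^ 2)⁻¹ n) := by
  have hl : 0 < (c ^ 2)⁻¹ := by positivity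
  unfold binomPMF
  rw [(aux_param c hc n hn).1]
  simp only [Nat.choose_zero_right, pow_zero, Nat.sub_zero, Nat.cast_one, one_mul]
  exact aux_pow _ hl n hn

theorem aux_ratio (c : ℝ) (hc : 0 < c) (n : ℕ) (hn : 1 ≤ n) (k : ℕ) :
    binomPMF n ((1 + c ^ 2 * n)⁻¹) k ≤
      Real.exp (auxX (c ^ 2)⁻¹ n) * poisPMF (c ^ 2)⁻¹ k := by
  have hl : 0 < (c ^ 2)⁻¹ := by positivity
  have hn0 : (0 : ℝ) < n := by exact_mod_cast hn
  have hp := aux_pow _ hl n hn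
  obtain ⟨h1, h2⟩ := aux_param c hc n hn
  unfold binomPMF poisPMF
  rw [h1, h2]
  generalize (c ^ 2)⁻¹ = l at *
  generalize hq : 1 / (1 + l / (n : ℝ)) = q at *
  by_cases hk : k ≤ n
  · have e : (l / n * q) ^ k * q ^ (n - k) = (l / n) ^ k * q ^ n := by
      rw [mul_pow, mul_assoc, ← pow_add, Nat.add_sub_cancel' hk]
    rw [mul_assoc, e, hp]
    have hch : (n.choose k : ℝ) ≤ (n : ℝ) ^ k / k.factorial := Nat.choose_le_pow_div k n
    calc _ ≤ (n : ℝ) ^ k / k.factorial * ((l / n) ^ k *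
            (Real.exp (-l) * Real.exp (auxX l n))) :=
          mul_le_mul_of_nonneg_right hch (by positivity)
      _ = _ := by rw [div_pow]; field_simp
  · rw [Nat.choose_eq_zero_of_lt (by omega)]
    simp only [Nat.cast_zero, zero_mul]
    positivity

theorem aux_tv_bdd {μ ν : Measure ℕ} [IsProbabilityMeasure μ] [IsProbabilityMeasure ν] :
    BddAbove (Set.range fun A : {s : Set ℕ // MeasurableSet s} =>
      |(μ A.1).toReal - (ν A.1).toReal|) := by
  refine ⟨1, ?_⟩
  rintro _ ⟨A, rfl⟩
  have h1 : μ.real A.1 ≤ 1 := measureReal_le_one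
  have h2 : ν.real A.1 ≤ 1 := measureReal_le_one
  have h3 : 0 ≤ μ.real A.1 := measureReal_nonneg
  have h4 : 0 ≤ ν.real A.1 := measureReal_nonneg
  change |μ.real A.1 - ν.real A.1| ≤ 1
  rw [abs_le]; constructor <;> linarith

theorem aux_tv_le {μ ν : Measure ℕ} [IsProbabilityMeasure μ] [IsProbabilityMeasure ν]
    (R : ℝ) (hR : 1 ≤ R) (h : ∀ k, μ {k} ≤ ENNReal.ofReal R * ν {k}) :
    tvDist μ ν ≤ R - 1 := by
  have hle : ∀ A : Set ℕ, μ A ≤ ENNReal.ofReal R * ν A := by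
    intro A
    rw [← Measure.tsum_indicator_apply_singleton μ A (.of_discrete),
      ← Measure.tsum_indicator_apply_singleton ν A (.of_discrete), ← ENNReal.tsum_mul_left]
    refine ENNReal.tsum_le_tsum fun k => ?_
    by_cases hk : k ∈ A
    · simpa [hk] using h k
    · simp [hk]
  have hone : ∀ A : Set ℕ, μ.real A - ν.real A ≤ R - 1 := by
    intro A
    have h1 : μ.real A ≤ R * ν.real A := by
      have := ENNReal.toReal_mono (by finiteness) (hle A)
      rwa [ENNReal.toReal_mul, ENNReal.toReal_ofReal (by linarith)] at this
    have h2 : ν.real A ≤ 1 := measureReal_le_one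
    nlinarith
  unfold tvDist
  have : Nonempty {s : Set ℕ // MeasurableSet s} := ⟨⟨∅, MeasurableSet.empty⟩⟩
  refine ciSup_le fun A => ?_
  change |μ.real A.1 - ν.real A.1| ≤ R - 1
  rw [abs_le]
  have h1 := hone A.1
  have h2 := hone A.1ᶜ
  rw [probReal_compl_eq_one_sub A.2, probReal_compl_eq_one_sub A.2] at h2
  constructor <;> linarith

/-- Sharp `n⁻¹` total-variation rate in the canonical Poisson regime: with
`δ_n = (1+c²n)⁻¹`, `P_n = Bin(n,δ_n)`, `P_∞ = Poi(1/c²)`, eventually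
`(e^{-1/c²}/(4c⁴))/n ≤ TV(P_n,P_∞) ≤ (2/c⁴)/n`, and the atom at `0` satisfies
`P_n{0} - P_∞{0} = (e^{-1/c²}/(2c⁴))/n + O(n⁻²)`. -/
theorem stmt4 (c : ℝ) (hc : 0 < c) (Pn : ℕ → Measure ℕ) (Pinf : Measure ℕ)
    [∀ n, IsProbabilityMeasure (Pn n)] [IsProbabilityMeasure Pinf]
    (hPn : ∀ n k, Pn n {k} = ENNReal.ofReal (binomPMF n ((1 + c ^ 2 * n)⁻¹) k))
    (hPinf : ∀ k, Pinf {k} = ENNReal.ofReal (poisPMF (c ^ 2)⁻¹ k)) :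
    (∃ N : ℕ, ∀ n : ℕ, N ≤ n →
      (Real.exp (-(c ^ 2)⁻¹) / (4 * c ^ 4)) * (1 / n) ≤ tvDist (Pn n) Pinf
      ∧ tvDist (Pn n) Pinf ≤ (2 / c ^ 4) * (1 / n))
    ∧ ∃ C : ℝ, ∀ n : ℕ, 1 ≤ n →
      |(Pn n {0}).toReal - (Pinf {0}).toReal
        - (Real.exp (-(c ^ 2)⁻¹) / (2 * c ^ 4)) * (1 / n)| ≤ C / n ^ 2 := by
  have hl : 0 < (c ^ 2)⁻¹ := by positivity
  have hc4 : ∀ a : ℝ, a / c ^ 4 = a * (c ^ 2)⁻¹ ^ 2 := by intro a; field_simp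
  have hc4b : ∀ a b : ℝ, a / (b * c ^ 4) = a * (c ^ 2)⁻¹ ^ 2 / b := by
    intro a b; rw [div_mul_eq_div_div, hc4]; ring
  have hdiff : ∀ n : ℕ, 1 ≤ n → (Pn n {0}).toReal - (Pinf {0}).toReal =
      Real.exp (-(c ^ 2)⁻¹) * (Real.exp (auxX (c ^ 2)⁻¹ n) - 1) := by
    intro n hn
    rw [hPn, hPinf, aux_zero c hc n hn, ENNReal.toReal_ofReal (by positivity),
      ENNReal.toReal_ofReal (by unfold poisPMF; positivity)]
    simp [poisPMF]
    ring
  have htv : ∀ n : ℕ, 1 ≤ n → tvDist (Pn n) Pinf ≤ Real.exp (auxX (c ^ 2)⁻¹ n) - 1 := by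
    intro n hn
    refine aux_tv_le _ (Real.one_le_exp (auxX_nonneg _ hl n)) fun k => ?_
    rw [hPn, hPinf, ← ENNReal.ofReal_mul (by positivity)]
    exact ENNReal.ofReal_le_ofReal (aux_ratio c hc n hn k)
  rw [hc4, hc4b, hc4b]
  generalize (c ^ 2)⁻¹ = l at *
  constructor
  · obtain ⟨N, hN⟩ := exists_nat_ge (max (l ^ 2 / 2) (4 / 3 * l))
    refine ⟨N + 1, fun n hn => ?_⟩
    have hn1 : 1 ≤ n := by omega
    have hn0 : (0 : ℝ) < n := by exact_mod_cast hn1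
    have hNn : (N : ℝ) ≤ n := by exact_mod_cast (by omega : N ≤ n)
    have hb1 : l ^ 2 / 2 ≤ n := (le_max_left _ _).trans (hN.trans hNn)
    have hb2 : 4 / 3 * l ≤ n := (le_max_right _ _).trans (hN.trans hNn)
    obtain ⟨hx1, hx2⟩ := auxX_bounds l hl n hn1
    have hx0 := auxX_nonneg l hl n
    constructor
    · have h0 : (Pn n {0}).toReal - (Pinf {0}).toReal ≤ tvDist (Pn n) Pinf :=
        (le_abs_self _).trans (le_ciSup (aux_tv_bdd (μ := Pn n) (ν := Pinf))
          ⟨{0}, MeasurableSet.of_discrete⟩)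
      refine le_trans ?_ h0
      rw [hdiff n hn1]
      have h4 : l ^ 2 / (4 * n) ≤ auxX l n := by
        refine le_trans ?_ hx1
        rw [div_sub_div _ _ (by positivity) (by positivity),
          div_le_div_iff₀ (by positivity) (by positivity)]
        have : 0 ≤ l ^ 2 * n ^ 2 * (n - 4 / 3 * l) :=
          mul_nonneg (by positivity) (by linarith)
        nlinarith
      have h5 := Real.add_one_le_exp (auxX l n)
      calc Real.exp (-l) * l ^ 2 / 4 * (1 / n) = Real.exp (-l) * (l ^ 2 / (4 * n)) := by
            field_simp
        _ ≤ _ := mul_le_mul_of_nonneg_left (by linarith) (Real.exp_pos _).le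
    · refine (htv n hn1).trans ?_
      have hx3 : auxX l n ≤ 1 := by
        refine hx2.trans ?_
        rw [div_le_one (by positivity)]; linarith
      have h6 := Real.abs_exp_sub_one_sub_id_le (x := auxX l n)
        (by rw [abs_of_nonneg hx0]; exact hx3)
      have h7 := (abs_le.1 h6).2
      have h8 : auxX l n ^ 2 ≤ auxX l n := by nlinarith
      have h9 : 2 * l ^ 2 * (1 / n) = 4 * (l ^ 2 / (2 * n)) := by field_simp; ring
      rw [h9]
      linarith
  · refine ⟨Real.exp (-l) * (l ^ 4 / 4 * Real.exp (l ^ 2 / 2) + l ^ 3 / 3), fun n hn => ?_⟩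
    have hn0 : (0 : ℝ) < n := by exact_mod_cast hn
    have hn1 : (1 : ℝ) ≤ n := by exact_mod_cast hn
    obtain ⟨hx1, hx2⟩ := auxX_bounds l hl n hn
    have hx0 := auxX_nonneg l hl n
    rw [hdiff n hn]
    have e1 : Real.exp (-l) * (Real.exp (auxX l n) - 1) - Real.exp (-l) * l ^ 2 / 2 * (1 / n)
        = Real.exp (-l) * (Real.exp (auxX l n) - 1 - l ^ 2 / (2 * n)) := by field_simp
    rw [e1, abs_mul, abs_of_pos (Real.exp_pos _), mul_div_assoc]
    refine mul_le_mul_of_nonneg_left ?_ (Real.exp_pos _).le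
    have hE := aux_exp _ hx0
    have hE2 := Real.add_one_le_exp (auxX l n)
    have hx3 : auxX l n ≤ l ^ 2 / 2 := by
      refine hx2.trans ?_
      apply div_le_div_of_nonneg_left (by positivity) (by positivity); linarith
    have hq : auxX l n ^ 2 * Real.exp (auxX l n) ≤
        (l ^ 2 / (2 * n)) ^ 2 * Real.exp (l ^ 2 / 2) := by gcongr
    have e2 : (l ^ 4 / 4 * Real.exp (l ^ 2 / 2) + l ^ 3 / 3) / n ^ 2 =
        (l ^ 2 / (2 * n)) ^ 2 * Real.exp (l ^ 2 / 2) + l ^ 3 / (3 * n ^ 2) := by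
      field_simp; ring
    have p1 : 0 ≤ (l ^ 2 / (2 * n)) ^ 2 * Real.exp (l ^ 2 / 2) := by positivity
    have p2 : 0 ≤ l ^ 3 / (3 * (n : ℝ) ^ 2) := by positivity
    rw [e2, abs_le]
    constructor <;> linarith
end

section
/- Let λ > 0, let P_∞ = Poisson(λ), let Q_∞ be the law of 1 + J with J ~ Poisson(λ), and for ε ≥ 0 set m_ε := ⌊λ e^ε⌋ + 1. Then δ_{Q_∞‖P_∞}(ε) = P(J ≥ m_ε − 1) − e^ε · P(J ≥ m_ε). Furthermore, the trade-off function f_{P_∞,Q_∞}(α) := inf{ E_{Q_∞}[1 − φ] : φ measurable with values in [0,1], E_{P_∞}[φ] ≤ α } satisfies: f_{P_∞,Q_∞}(0) = 1; f_{P_∞,Q_∞}(α) = 0 for α ∈ [P(J ≥ 1), 1]; and for every m ≥ 1 and every α with P(J ≥ m+1) ≤ α ≤ P(J ≥ m), f_{P_∞,Q_∞}(α) = P(J ≤ m−1) − (m/λ)·(α − P(J ≥ m+1)). Moreover δ_{Q_∞‖P_∞}(ε) = sup_{α ∈ [0,1]} {1 − f_{P_∞,Q_∞}(α) − e^ε α}.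 -/
open MeasureTheory Filter

/-- Trade-off (Neyman–Pearson) function: minimal type-II error
`f_{P,Q}(α) = inf { E_Q[1-φ] : φ measurable, 0 ≤ φ ≤ 1, E_P[φ] ≤ α }`. -/
noncomputable def tradeoff {Ω : Type*} [MeasurableSpace Ω] (P Q : Measure Ω) (α : ℝ) : ℝ :=
  sInf {r : ℝ | ∃ φ : Ω → ℝ, Measurable φ ∧ (∀ x, 0 ≤ φ x ∧ φ x ≤ 1)
    ∧ (∫ x, φ x ∂P) ≤ α ∧ r = ∫ x, (1 - φ x) ∂Q}

theorem aux_pos (l : ℝ) (hl : 0 < l) (k : ℕ) : 0 < poisPMF l k := by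
  unfold poisPMF; positivity

theorem aux_rec (l : ℝ) (hl : 0 < l) (k : ℕ) :
    (if k = 0 then 0 else poisPMF l (k - 1)) = (k : ℝ) / l * poisPMF l k := by
  rcases k with _ | k
  · simp
  · have h : ((k.factorial : ℕ) : ℝ) ≠ 0 := by positivity
    simp only [poisPMF, Nat.factorial_succ, pow_succ]
    rw [if_neg (Nat.succ_ne_zero k), Nat.add_sub_cancel]
    push_cast
    have h2 : ((k : ℝ) + 1) ≠ 0 := by positivity
    field_simp

theorem aux_bdd (P : Measure ℕ) [IsProbabilityMeasure P] (φ : ℕ → ℝ)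
    (h : ∀ x, 0 ≤ φ x ∧ φ x ≤ 1) : Integrable φ P := by
  refine Integrable.of_bound (C := 1) (Measurable.of_discrete.aestronglyMeasurable) ?_
  refine Eventually.of_forall fun x => ?_
  rw [Real.norm_eq_abs, abs_of_nonneg (h x).1]
  exact (h x).2

theorem aux_dens (l : ℝ) (hl : 0 < l) (P Q : Measure ℕ)
    (hP : ∀ k, P {k} = ENNReal.ofReal (poisPMF l k))
    (hQ : ∀ k, Q {k} = ENNReal.ofReal (if k = 0 then 0 else poisPMF l (k - 1))) :
    Q = P.withDensity (fun k => ((Real.toNNReal ((k : ℝ) / l) : NNReal) : ENNReal)) := by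
  refine Measure.ext_of_singleton fun k => ?_
  rw [withDensity_apply _ (measurableSet_singleton k), hQ, aux_rec l hl, lintegral_singleton, hP,
    ENNReal.ofReal_mul (by positivity)]
  rfl

theorem aux_map (l : ℝ) (P Q : Measure ℕ)
    (hP : ∀ k, P {k} = ENNReal.ofReal (poisPMF l k))
    (hQ : ∀ k, Q {k} = ENNReal.ofReal (if k = 0 then 0 else poisPMF l (k - 1))) :
    Q = P.map (fun k => k + 1) := by
  refine Measure.ext_of_singleton fun k => ?_
  rw [Measure.map_apply Measurable.of_discrete (measurableSet_singleton k), hQ]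
  rcases k with _ | k
  · have : (fun k : ℕ => k + 1) ⁻¹' {0} = ∅ := by ext; simp
    rw [this]; simp
  · have : (fun k : ℕ => k + 1) ⁻¹' {k + 1} = {k} := by ext; simp
    rw [this, hP]; simp

theorem aux_tail (l : ℝ) (P Q : Measure ℕ)
    (hP : ∀ k, P {k} = ENNReal.ofReal (poisPMF l k))
    (hQ : ∀ k, Q {k} = ENNReal.ofReal (if k = 0 then 0 else poisPMF l (k - 1))) (m : ℕ) :
    Q {j | m + 1 ≤ j} = P {j | m ≤ j} := by
  rw [aux_map l P Q hP hQ, Measure.map_apply Measurable.of_discrete (MeasurableSet.of_discrete)]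
  congr 1
  ext; simp

/-- Neyman-Pearson. -/
theorem aux_np (l : ℝ) (hl : 0 < l) (P Q : Measure ℕ)
    [IsProbabilityMeasure P] [IsProbabilityMeasure Q]
    (hP : ∀ k, P {k} = ENNReal.ofReal (poisPMF l k))
    (hQ : ∀ k, Q {k} = ENNReal.ofReal (if k = 0 then 0 else poisPMF l (k - 1)))
    (c : ℝ) (φ ψ : ℕ → ℝ) (hφ : ∀ x, 0 ≤ φ x ∧ φ x ≤ 1) (hψ : ∀ x, 0 ≤ ψ x ∧ ψ x ≤ 1)
    (h : ∀ k : ℕ, 0 ≤ (ψ k - φ k) * ((k : ℝ) / l - c)) :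
    (∫ x, φ x ∂Q) - c * (∫ x, φ x ∂P) ≤ (∫ x, ψ x ∂Q) - c * (∫ x, ψ x ∂P) := by
  have hd := aux_dens l hl P Q hP hQ
  have key : ∀ f : ℕ → ℝ, (∀ x, 0 ≤ f x ∧ f x ≤ 1) →
      Integrable (fun k : ℕ => (k : ℝ) / l * f k) P ∧ ∫ x, f x ∂Q = ∫ k, (k : ℝ) / l * f k ∂P := by
    intro f hf
    have hi := aux_bdd Q f hf
    have e : ∀ k : ℕ, (Real.toNNReal ((k : ℝ) / l)) • f k = (k : ℝ) / l * f k := by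
      intro k
      rw [NNReal.smul_def, Real.coe_toNNReal _ (by positivity), smul_eq_mul]
    constructor
    · rw [hd, integrable_withDensity_iff_integrable_smul Measurable.of_discrete] at hi
      simpa only [e] using hi
    · rw [hd, integral_withDensity_eq_integral_smul Measurable.of_discrete]
      simp only [e]
  obtain ⟨i1, e1⟩ := key φ hφ
  obtain ⟨i2, e2⟩ := key ψ hψ
  have j1 := (aux_bdd P φ hφ).const_mul c
  have j2 := (aux_bdd P ψ hψ).const_mul c
  rw [e1, e2, ← integral_const_mul, ← integral_const_mul, ← integral_sub i1 j1,
    ← integral_sub i2 j2]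
  refine integral_mono (i1.sub j1) (i2.sub j2) fun k => ?_
  have := h k
  simp only
  nlinarith

theorem aux_ind (P : Measure ℕ) (A : Set ℕ) :
    ∫ x, A.indicator (fun _ => (1 : ℝ)) x ∂P = (P A).toReal := by
  rw [integral_indicator MeasurableSet.of_discrete]
  simp [Measure.real]

theorem aux_ind01 (A : Set ℕ) (x : ℕ) :
    0 ≤ A.indicator (fun _ => (1 : ℝ)) x ∧ A.indicator (fun _ => (1 : ℝ)) x ≤ 1 := by
  by_cases h : x ∈ A <;> simp [h]

theorem aux_one_sub (Q : Measure ℕ) [IsProbabilityMeasure Q] (φ : ℕ → ℝ)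
    (h : ∀ x, 0 ≤ φ x ∧ φ x ≤ 1) : ∫ x, (1 - φ x) ∂Q = 1 - ∫ x, φ x ∂Q := by
  rw [integral_sub (integrable_const _) (aux_bdd Q φ h)]
  simp

theorem aux_le (P Q : Measure ℕ) [IsProbabilityMeasure P] [IsProbabilityMeasure Q] (α : ℝ)
    (φ : ℕ → ℝ) (h : ∀ x, 0 ≤ φ x ∧ φ x ≤ 1) (hα : ∫ x, φ x ∂P ≤ α) :
    tradeoff P Q α ≤ 1 - ∫ x, φ x ∂Q := by
  refine csInf_le ⟨0, ?_⟩ ⟨φ, Measurable.of_discrete, h, hα, (aux_one_sub Q φ h).symm⟩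
  rintro r ⟨f, -, hf, -, rfl⟩
  exact integral_nonneg fun x => sub_nonneg.2 (hf x).2

theorem aux_ge (P Q : Measure ℕ) [IsProbabilityMeasure P] [IsProbabilityMeasure Q] (α : ℝ)
    (hα : 0 ≤ α) (b : ℝ) (h : ∀ φ : ℕ → ℝ, (∀ x, 0 ≤ φ x ∧ φ x ≤ 1) → ∫ x, φ x ∂P ≤ α →
      b ≤ 1 - ∫ x, φ x ∂Q) : b ≤ tradeoff P Q α := by
  refine le_csInf ⟨_, fun _ => 0, Measurable.of_discrete, by simp, by simpa using hα, rfl⟩ ?_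
  rintro r ⟨f, -, hf, hfα, rfl⟩
  rw [aux_one_sub Q f hf]
  exact h f hf hfα

theorem aux_int_le_one (Q : Measure ℕ) [IsProbabilityMeasure Q] (φ : ℕ → ℝ)
    (h : ∀ x, 0 ≤ φ x ∧ φ x ≤ 1) : ∫ x, φ x ∂Q ≤ 1 := by
  have := integral_mono (aux_bdd Q φ h) (integrable_const (1 : ℝ)) (fun x => (h x).2)
  simpa using this

/-- Trade-off function of the Poisson-shift limit experiment
(`P_∞ = Poi(λ)`, `Q_∞ = 1 + Poi(λ)`) and recovery of the privacy curve:
with `m_ε = ⌊λe^ε⌋ + 1`, `δ_{Q_∞‖P_∞}(ε) = P(J ≥ m_ε - 1) - e^ε P(J ≥ m_ε)`;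
the trade-off function is piecewise affine with knots at the Poisson tails; and
`δ_{Q_∞‖P_∞}(ε) = sup_{α∈[0,1]} (1 - f(α) - e^ε α)`. -/
theorem stmt6 (lam : ℝ) (hlam : 0 < lam) (Pinf Qinf : Measure ℕ)
    [IsProbabilityMeasure Pinf] [IsProbabilityMeasure Qinf]
    (hPinf : ∀ k, Pinf {k} = ENNReal.ofReal (poisPMF lam k))
    (hQinf : ∀ k, Qinf {k} = ENNReal.ofReal (if k = 0 then 0 else poisPMF lam (k - 1)))
    (ε : ℝ) (hε : 0 ≤ ε) :
    (privDelta Pinf Qinf ε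
      = (Pinf {j : ℕ | Nat.floor (lam * Real.exp ε) ≤ j}).toReal
        - Real.exp ε * (Pinf {j : ℕ | Nat.floor (lam * Real.exp ε) + 1 ≤ j}).toReal)
    ∧ tradeoff Pinf Qinf 0 = 1
    ∧ (∀ α : ℝ, (Pinf {j : ℕ | 1 ≤ j}).toReal ≤ α → α ≤ 1 → tradeoff Pinf Qinf α = 0)
    ∧ (∀ m : ℕ, 1 ≤ m → ∀ α : ℝ,
        (Pinf {j : ℕ | m + 1 ≤ j}).toReal ≤ α → α ≤ (Pinf {j : ℕ | m ≤ j}).toReal →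
        tradeoff Pinf Qinf α
          = (Pinf {j : ℕ | j ≤ m - 1}).toReal
            - ((m : ℝ) / lam) * (α - (Pinf {j : ℕ | m + 1 ≤ j}).toReal))
    ∧ privDelta Pinf Qinf ε
        = ⨆ α : (Set.Icc (0:ℝ) 1), (1 - tradeoff Pinf Qinf α - Real.exp ε * α) := by
  have hnp : ∀ φ : ℕ → ℝ, (∀ x, 0 ≤ φ x ∧ φ x ≤ 1) →
      (∫ x, φ x ∂Qinf) - Real.exp ε * (∫ x, φ x ∂Pinf) ≤
      (Pinf {j : ℕ | Nat.floor (lam * Real.exp ε) ≤ j}).toReal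
        - Real.exp ε * (Pinf {j : ℕ | Nat.floor (lam * Real.exp ε) + 1 ≤ j}).toReal := by
    intro φ hφ
    have := aux_np lam hlam Pinf Qinf hPinf hQinf (Real.exp ε) φ
      ({j : ℕ | Nat.floor (lam * Real.exp ε) + 1 ≤ j}.indicator (fun _ => (1 : ℝ))) hφ
      (aux_ind01 _) ?_
    · rwa [aux_ind, aux_ind, aux_tail lam Pinf Qinf hPinf hQinf] at this
    · intro k
      by_cases hk : Nat.floor (lam * Real.exp ε) + 1 ≤ k
      · rw [Set.indicator_of_mem (by exact hk)]
        have h1 : lam * Real.exp ε < k := (Nat.floor_lt (by positivity)).1 hk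
        refine mul_nonneg (by linarith [(hφ k).2]) ?_
        rw [sub_nonneg, le_div_iff₀ hlam]
        linarith
      · rw [Set.indicator_of_notMem (by exact hk)]
        have h1 : (k : ℝ) ≤ lam * Real.exp ε :=
          (Nat.le_floor_iff (by positivity)).1 (by omega)
        refine mul_nonneg_of_nonpos_of_nonpos (by linarith [(hφ k).1]) ?_
        rw [sub_nonpos, div_le_iff₀ hlam]
        linarith
  have hD : privDelta Pinf Qinf ε
      = (Pinf {j : ℕ | Nat.floor (lam * Real.exp ε) ≤ j}).toReal
        - Real.exp ε * (Pinf {j : ℕ | Nat.floor (lam * Real.exp ε) + 1 ≤ j}).toReal := by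
    have hub : ∀ A : {s : Set ℕ // MeasurableSet s},
        (Qinf A.1).toReal - Real.exp ε * (Pinf A.1).toReal ≤
        (Pinf {j : ℕ | Nat.floor (lam * Real.exp ε) ≤ j}).toReal
        - Real.exp ε * (Pinf {j : ℕ | Nat.floor (lam * Real.exp ε) + 1 ≤ j}).toReal := by
      intro A
      have := hnp (A.1.indicator (fun _ => (1 : ℝ))) (aux_ind01 _)
      rwa [aux_ind, aux_ind] at this
    have : Nonempty {s : Set ℕ // MeasurableSet s} := ⟨⟨∅, MeasurableSet.empty⟩⟩
    refine le_antisymm (ciSup_le hub) ?_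
    refine le_ciSup_of_le ⟨_, by rintro _ ⟨A, rfl⟩; exact hub A⟩
      ⟨{j : ℕ | Nat.floor (lam * Real.exp ε) + 1 ≤ j}, MeasurableSet.of_discrete⟩ ?_
    simp only
    rw [aux_tail lam Pinf Qinf hPinf hQinf]
  refine ⟨hD, ?_, ?_, ?_, ?_⟩
  · refine le_antisymm ?_ ?_
    · have := aux_le Pinf Qinf 0 (fun _ => 0) (by simp) (by simp)
      simpa using this
    · refine aux_ge Pinf Qinf 0 le_rfl _ fun φ hφ h0 => ?_
      have h1 : ∫ x, φ x ∂Pinf = 0 := le_antisymm h0 (integral_nonneg fun x => (hφ x).1)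
      rw [integral_eq_zero_iff_of_nonneg (fun x => (hφ x).1) (aux_bdd _ φ hφ)] at h1
      have h2 : φ =ᵐ[Qinf] 0 := by
        have hac : Qinf ≪ Pinf := by
          rw [aux_dens lam hlam Pinf Qinf hPinf hQinf]
          exact withDensity_absolutelyContinuous _ _
        exact hac h1
      rw [integral_congr_ae h2]
      simp
  · intro α h1 h2
    refine le_antisymm ?_ ?_
    · have := aux_le Pinf Qinf α ({j : ℕ | 1 ≤ j}.indicator (fun _ => (1 : ℝ))) (aux_ind01 _)
        (by rw [aux_ind]; exact h1)
      rw [aux_ind, show {j : ℕ | 1 ≤ j} = {j : ℕ | 0 + 1 ≤ j} by simp,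
        aux_tail lam Pinf Qinf hPinf hQinf] at this
      simpa using this
    · refine aux_ge Pinf Qinf α (le_trans ENNReal.toReal_nonneg h1) _ fun φ hφ h0 => ?_
      linarith [aux_int_le_one Qinf φ hφ]
  · intro m hm α h1 h2
    have hp := aux_pos lam hlam m
    have hPm : (Pinf {m}).toReal = poisPMF lam m := by
      rw [hPinf, ENNReal.toReal_ofReal hp.le]
    have hQm : (Qinf {m}).toReal = (m : ℝ) / lam * poisPMF lam m := by
      rw [hQinf, aux_rec lam hlam, ENNReal.toReal_ofReal (by positivity)]
    have hsplit : (Pinf {j : ℕ | m ≤ j}).toReal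
        = poisPMF lam m + (Pinf {j : ℕ | m + 1 ≤ j}).toReal := by
      rw [← hPm, ← ENNReal.toReal_add (measure_ne_top _ _) (measure_ne_top _ _),
        ← measure_union (by simp) MeasurableSet.of_discrete]
      congr 2
      ext j
      simp only [Set.mem_ofPred_eq, Set.mem_union, Set.mem_singleton_iff]
      omega
    have hcompl : (Pinf {j : ℕ | j ≤ m - 1}).toReal = 1 - (Pinf {j : ℕ | m ≤ j}).toReal := by
      have : {j : ℕ | j ≤ m - 1} = {j : ℕ | m ≤ j}ᶜ := by
        ext j
        simp only [Set.mem_ofPred_eq, Set.mem_compl_iff]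
        omega
      rw [this]
      exact probReal_compl_eq_one_sub MeasurableSet.of_discrete
    obtain ⟨gam, hgam⟩ : ∃ gam, gam = (α - (Pinf {j : ℕ | m + 1 ≤ j}).toReal) / poisPMF lam m := ⟨_, rfl⟩
    have hgam0 : 0 ≤ gam := by rw [hgam]; exact div_nonneg (by linarith) hp.le
    have hgam1 : gam ≤ 1 := by rw [hgam, div_le_one hp]; linarith
    have hgamp : gam * poisPMF lam m = α - (Pinf {j : ℕ | m + 1 ≤ j}).toReal := by
      rw [hgam]; field_simp
    obtain ⟨ψ, hψ⟩ : ∃ ψ : ℕ → ℝ, ψ = fun k =>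
      {j : ℕ | m + 1 ≤ j}.indicator (fun _ => (1 : ℝ)) k
        + gam * ({m} : Set ℕ).indicator (fun _ => (1 : ℝ)) k := ⟨_, rfl⟩
    have hψgt : ∀ k, m < k → ψ k = 1 := by
      intro k hk
      have h3 : k ≠ m := by omega
      have h4 : m + 1 ≤ k := hk
      simp [hψ, Set.indicator, h3, hk]
    have hψlt : ∀ k, k < m → ψ k = 0 := by
      intro k hk
      have h3 : k ≠ m := by omega
      have h4 : ¬ (m + 1 ≤ k) := by omega
      simp only [hψ, Set.indicator, Set.mem_ofPred_eq, Set.mem_singleton_iff, h3, h4, if_false]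
      simp
    have hψm : ψ m = gam := by simp [hψ]
    have hψ01 : ∀ x, 0 ≤ ψ x ∧ ψ x ≤ 1 := by
      intro x
      rcases lt_trichotomy x m with h | h | h
      · rw [hψlt x h]; simp
      · rw [h, hψm]; exact ⟨hgam0, hgam1⟩
      · rw [hψgt x h]; simp
    have hint : ∀ (ν : Measure ℕ) [IsProbabilityMeasure ν], ∫ x, ψ x ∂ν
        = (ν {j : ℕ | m + 1 ≤ j}).toReal + gam * (ν {m}).toReal := by
      intro ν _
      rw [hψ, integral_add (aux_bdd ν _ (aux_ind01 _)) ((aux_bdd ν _ (aux_ind01 _)).const_mul gam),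
        integral_const_mul, aux_ind, aux_ind]
    have hψP : ∫ x, ψ x ∂Pinf = α := by rw [hint, hPm, hgamp]; ring
    have hψQ : ∫ x, ψ x ∂Qinf = (Pinf {j : ℕ | m ≤ j}).toReal
        + (m : ℝ) / lam * (α - (Pinf {j : ℕ | m + 1 ≤ j}).toReal) := by
      rw [hint, hQm, aux_tail lam Pinf Qinf hPinf hQinf, ← hgamp]; ring
    have hgoal : (Pinf {j : ℕ | j ≤ m - 1}).toReal
            - ((m : ℝ) / lam) * (α - (Pinf {j : ℕ | m + 1 ≤ j}).toReal)
        = 1 - ∫ x, ψ x ∂Qinf := by rw [hψQ, hcompl]; ring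
    rw [hgoal]
    refine le_antisymm (aux_le Pinf Qinf α ψ hψ01 hψP.le) ?_
    refine aux_ge Pinf Qinf α (le_trans ENNReal.toReal_nonneg h1) _ fun φ hφ h0 => ?_
    have := aux_np lam hlam Pinf Qinf hPinf hQinf ((m : ℝ) / lam) φ ψ hφ hψ01 ?_
    · rw [hψP] at this
      have h5 : (m : ℝ) / lam * (∫ x, φ x ∂Pinf) ≤ (m : ℝ) / lam * α :=
        mul_le_mul_of_nonneg_left h0 (by positivity)
      linarith
    · intro k
      rcases lt_trichotomy k m with h | h | h
      · rw [hψlt k h]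
        refine mul_nonneg_of_nonpos_of_nonpos (by linarith [(hφ k).1]) ?_
        rw [sub_nonpos]
        gcongr
      · rw [h]; simp
      · rw [hψgt k h]
        refine mul_nonneg (by linarith [(hφ k).2]) ?_
        rw [sub_nonneg]
        gcongr
  · rw [hD]
    have hub : ∀ α : Set.Icc (0:ℝ) 1, 1 - tradeoff Pinf Qinf α - Real.exp ε * α ≤
        (Pinf {j : ℕ | Nat.floor (lam * Real.exp ε) ≤ j}).toReal
        - Real.exp ε * (Pinf {j : ℕ | Nat.floor (lam * Real.exp ε) + 1 ≤ j}).toReal := by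
      intro α
      have := aux_ge Pinf Qinf α α.2.1 (1 - Real.exp ε * α -
        ((Pinf {j : ℕ | Nat.floor (lam * Real.exp ε) ≤ j}).toReal
        - Real.exp ε * (Pinf {j : ℕ | Nat.floor (lam * Real.exp ε) + 1 ≤ j}).toReal)) ?_
      · linarith
      · intro φ hφ h0
        have h5 : Real.exp ε * (∫ x, φ x ∂Pinf) ≤ Real.exp ε * α :=
          mul_le_mul_of_nonneg_left h0 (by positivity)
        linarith [hnp φ hφ]
    have : Nonempty (Set.Icc (0:ℝ) 1) := ⟨⟨0, by simp⟩⟩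
    refine le_antisymm ?_ (ciSup_le hub)
    refine le_ciSup_of_le ⟨_, by rintro _ ⟨A, rfl⟩; exact hub A⟩
      ⟨(Pinf {j : ℕ | Nat.floor (lam * Real.exp ε) + 1 ≤ j}).toReal, ENNReal.toReal_nonneg,
        measureReal_le_one⟩ ?_
    have := aux_le Pinf Qinf (Pinf {j : ℕ | Nat.floor (lam * Real.exp ε) + 1 ≤ j}).toReal
      ({j : ℕ | Nat.floor (lam * Real.exp ε) + 1 ≤ j}.indicator (fun _ => (1 : ℝ)))
      (aux_ind01 _) (by rw [aux_ind])
    rw [aux_ind, aux_tail lam Pinf Qinf hPinf hQinf] at this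
    simp only
    linarith
end

section
/- For λ > 0, let P_λ = Poisson(λ) and let Q_λ be the law of 1 + J with J ~ Poisson(λ). Then: (i) for fixed λ, the map ε ↦ δ_{Q_λ‖P_λ}(ε) is strictly decreasing on [0, ∞); (ii) for fixed ε ≥ 0, the map λ ↦ δ_{Q_λ‖P_λ}(ε) is strictly decreasing on (0, ∞); (iii) the reverse curve ε ↦ δ_{P_λ‖Q_λ}(ε) is strictly decreasing until it reaches the value e^{−λ}, after which it is constant; in particular δ_{P_λ‖Q_λ}(ε) = e^{−λ} whenever e^ε ≥ λ, and δ_{P_λ‖Q_λ}(ε) ≥ e^{−λ} for all ε ≥ 0. -/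
open MeasureTheory Filter

lemma val_sum (μ ν : Measure ℕ) [IsProbabilityMeasure μ] [IsProbabilityMeasure ν] (c : ℝ)
    (A : Set ℕ) :
    HasSum (A.indicator (fun k => (ν {k}).toReal - c * (μ {k}).toReal))
      ((ν A).toReal - c * (μ A).toReal) := by
  have key : ∀ (ρ : Measure ℕ) [IsProbabilityMeasure ρ],
      HasSum (A.indicator (fun k => (ρ {k}).toReal)) (ρ A).toReal := by
    intro ρ _
    have h := Measure.tsum_indicator_apply_singleton ρ A (MeasurableSet.of_discrete)
    have h2 : A.indicator (fun k => (ρ {k}).toReal)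
        = fun k => (A.indicator (fun x => ρ {x}) k).toReal := by
      funext k
      by_cases hk : k ∈ A <;> simp [hk]
    have hne : ∑' k, A.indicator (fun x => ρ {x}) k ≠ ⊤ := by
      rw [h]
      exact measure_ne_top _ _
    rw [h2, ← h, ENNReal.tsum_toReal_eq (fun k => ENNReal.ne_top_of_tsum_ne_top hne k)]
    exact ENNReal.hasSum_toReal hne
  have := (key ν).sub ((key μ).mul_left c)
  have e : A.indicator (fun k => (ν {k}).toReal - c * (μ {k}).toReal)
      = fun b => A.indicator (fun k => (ν {k}).toReal) b
        - c * A.indicator (fun k => (μ {k}).toReal) b := by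
    funext k
    by_cases hk : k ∈ A <;> simp [hk]
  rw [e]
  exact this

lemma val_bdd (μ ν : Measure ℕ) [IsProbabilityMeasure μ] [IsProbabilityMeasure ν] (ε : ℝ) :
    BddAbove (Set.range (fun A : {s : Set ℕ // MeasurableSet s} =>
      ((ν A.1).toReal - Real.exp ε * (μ A.1).toReal))) := by
  refine ⟨1, ?_⟩
  rintro _ ⟨A, rfl⟩
  have h1 : (ν A.1).toReal ≤ 1 := by
    have := measureReal_le_one (μ := ν) (s := A.1)
    exact this
  have h2 : 0 ≤ Real.exp ε * (μ A.1).toReal := by positivity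
  simp only
  linarith

lemma val_le (μ ν : Measure ℕ) [IsProbabilityMeasure μ] [IsProbabilityMeasure ν] (ε : ℝ)
    (A : Set ℕ) : (ν A).toReal - Real.exp ε * (μ A).toReal ≤ privDelta μ ν ε :=
  le_ciSup (val_bdd μ ν ε) (⟨A, MeasurableSet.of_discrete⟩ : {s : Set ℕ // MeasurableSet s})

/-- Neyman-Pearson: the supremum is attained on the likelihood-ratio set. -/
lemma attained (μ ν : Measure ℕ) [IsProbabilityMeasure μ] [IsProbabilityMeasure ν] (ε : ℝ)
    (S : Set ℕ) (hS : S = {k | 0 < (ν {k}).toReal - Real.exp ε * (μ {k}).toReal}) :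
    privDelta μ ν ε = (ν S).toReal - Real.exp ε * (μ S).toReal := by
  apply le_antisymm _ (val_le μ ν ε S)
  have : Nonempty {s : Set ℕ // MeasurableSet s} := ⟨⟨∅, MeasurableSet.empty⟩⟩
  apply ciSup_le
  rintro ⟨A, hA⟩
  refine hasSum_le ?_ (val_sum μ ν (Real.exp ε) A) (val_sum μ ν (Real.exp ε) S)
  intro k
  by_cases hk : k ∈ A <;> by_cases hs : k ∈ S <;> simp only [hk, hs, Set.indicator_of_mem,
    Set.indicator_of_notMem, not_false_eq_true, le_refl]
  · rw [hS] at hs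
    simpa using hs
  · rw [hS] at hs
    exact le_of_lt hs

lemma poisPMF_pos {l : ℝ} (hl : 0 < l) (k : ℕ) : 0 < poisPMF l k := by
  unfold poisPMF; positivity

lemma poisPMF_succ (l : ℝ) (k : ℕ) : poisPMF l (k + 1) * (k + 1) = l * poisPMF l k := by
  unfold poisPMF
  rw [Nat.factorial_succ]
  push_cast
  field_simp
  ring

lemma eq_poisson (μ : Measure ℕ) (l : NNReal)
    (h : ∀ k, μ {k} = ENNReal.ofReal (poisPMF l k)) : μ = ProbabilityTheory.poissonMeasure l := by
  apply Measure.ext_of_singleton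
  intro k
  rw [h, ProbabilityTheory.poissonMeasure_singleton]
  rfl

lemma eq_map (μ ν : Measure ℕ) (l : ℝ)
    (h : ∀ k, μ {k} = ENNReal.ofReal (poisPMF l k))
    (h' : ∀ k, ν {k} = ENNReal.ofReal (if k = 0 then 0 else poisPMF l (k - 1))) :
    ν = μ.map Nat.succ := by
  apply Measure.ext_of_singleton
  intro k
  rw [Measure.map_apply (by fun_prop) (by simp), h']
  cases k with
  | zero =>
    have : Nat.succ ⁻¹' {0} = ∅ := by ext; simp
    simp [this]
  | succ k =>
    have : Nat.succ ⁻¹' {k+1} = {k} := by ext; simp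
    rw [this, h]
    simp

lemma poisson_shift (a b : NNReal) (B : Set ℕ) :
    Integrable (fun y => (ProbabilityTheory.poissonMeasure a ((fun x => y + x) ⁻¹' B)).toReal)
      (ProbabilityTheory.poissonMeasure b) ∧
    (ProbabilityTheory.poissonMeasure (b + a) B).toReal =
      ∫ y, (ProbabilityTheory.poissonMeasure a ((fun x => y + x) ⁻¹' B)).toReal
        ∂(ProbabilityTheory.poissonMeasure b) := by
  constructor
  · apply Integrable.of_bound (C := 1) (Measurable.of_discrete.aestronglyMeasurable)
    filter_upwards with y
    rw [Real.norm_of_nonneg ENNReal.toReal_nonneg]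
    exact measureReal_le_one
  · rw [← ProbabilityTheory.poissonMeasure_conv_poissonMeasure, Measure.conv,
      Measure.map_apply (by fun_prop) MeasurableSet.of_discrete,
      Measure.prod_apply MeasurableSet.of_discrete, integral_toReal Measurable.of_discrete.aemeasurable]
    · rfl
    · filter_upwards with y
      exact measure_lt_top _ _

/-- Monotonicity of the Poisson-shift limiting curves, for `P_λ = Poi(λ)`,
`Q_λ = law(1 + Poi(λ))`:
(i) for fixed `λ > 0`, `ε ↦ δ_{Q_λ‖P_λ}(ε)` is strictly decreasing on `[0,∞)`;
(ii) for fixed `ε ≥ 0`, `λ ↦ δ_{Q_λ‖P_λ}(ε)` is strictly decreasing on `(0,∞)`;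
(iii) the reverse curve `ε ↦ δ_{P_λ‖Q_λ}(ε)` is nonincreasing, strictly decreasing while
above the floor `e^{-λ}`, equals `e^{-λ}` once `e^ε ≥ λ`, and is always `≥ e^{-λ}`. -/
theorem stmt7 (P Q : ℝ → Measure ℕ)
    [∀ l, IsProbabilityMeasure (P l)] [∀ l, IsProbabilityMeasure (Q l)]
    (hP : ∀ l : ℝ, 0 < l → ∀ k, P l {k} = ENNReal.ofReal (poisPMF l k))
    (hQ : ∀ l : ℝ, 0 < l → ∀ k,
      Q l {k} = ENNReal.ofReal (if k = 0 then 0 else poisPMF l (k - 1))) :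
    (∀ l : ℝ, 0 < l → StrictAntiOn (fun ε => privDelta (P l) (Q l) ε) (Set.Ici 0))
    ∧ (∀ ε : ℝ, 0 ≤ ε → StrictAntiOn (fun l => privDelta (P l) (Q l) ε) (Set.Ioi 0))
    ∧ (∀ l : ℝ, 0 < l → ∀ ε₁ ε₂ : ℝ, 0 ≤ ε₁ → ε₁ < ε₂ →
        privDelta (Q l) (P l) ε₂ ≤ privDelta (Q l) (P l) ε₁
        ∧ (Real.exp (-l) < privDelta (Q l) (P l) ε₁ →
            privDelta (Q l) (P l) ε₂ < privDelta (Q l) (P l) ε₁))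
    ∧ (∀ l : ℝ, 0 < l → ∀ ε : ℝ, 0 ≤ ε → l ≤ Real.exp ε →
        privDelta (Q l) (P l) ε = Real.exp (-l))
    ∧ (∀ l : ℝ, 0 < l → ∀ ε : ℝ, 0 ≤ ε →
        Real.exp (-l) ≤ privDelta (Q l) (P l) ε) := by
  have pR : ∀ l : ℝ, 0 < l → ∀ k, (P l {k}).toReal = poisPMF l k := by
    intro l hl k
    rw [hP l hl, ENNReal.toReal_ofReal (poisPMF_pos hl k).le]
  have qR : ∀ l : ℝ, 0 < l → ∀ k, (Q l {k + 1}).toReal = poisPMF l k := by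
    intro l hl k
    rw [hQ l hl]
    simp [(poisPMF_pos hl k).le]
  have qR0 : ∀ l : ℝ, 0 < l → (Q l {0}).toReal = 0 := by
    intro l hl
    rw [hQ l hl]
    simp
  have p0 : ∀ l : ℝ, poisPMF l 0 = Real.exp (-l) := by
    intro l; simp [poisPMF]
  -- large points lie in the likelihood-ratio set
  have big : ∀ l : ℝ, 0 < l → ∀ ε : ℝ, ∀ k : ℕ, l * Real.exp ε < k →
      0 < (Q l {k}).toReal - Real.exp ε * (P l {k}).toReal := by
    intro l hl ε k hk
    cases k with
    | zero =>
      exfalso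
      have : 0 < l * Real.exp ε := by positivity
      simp at hk
      linarith
    | succ k =>
      rw [qR l hl, pR l hl]
      have h1 := poisPMF_succ l k
      have h2 := poisPMF_pos hl (k + 1)
      push_cast at hk
      have h3 : 0 < poisPMF l (k + 1) * (k + 1 - l * Real.exp ε) :=
        mul_pos h2 (by linarith)
      have h4 : 0 < l * (poisPMF l k - Real.exp ε * poisPMF l (k + 1)) := by
        nlinarith
      exact pos_of_mul_pos_right h4 hl.le
  have floor : ∀ l : ℝ, 0 < l → ∀ ε : ℝ, 0 ≤ ε →
      Real.exp (-l) ≤ privDelta (Q l) (P l) ε := by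
    intro l hl ε _
    have := val_le (Q l) (P l) ε {0}
    rw [pR l hl, qR0 l hl, p0] at this
    simpa using this
  have sub0 : ∀ l : ℝ, 0 < l → ∀ A : Set ℕ, A ⊆ {0} → ∀ c : ℝ, 0 ≤ c →
      (P l A).toReal - c * (Q l A).toReal ≤ Real.exp (-l) := by
    intro l hl A hA c hc
    have h1 : (P l A).toReal ≤ (P l {0}).toReal :=
      ENNReal.toReal_mono (measure_ne_top _ _) (measure_mono hA)
    rw [pR l hl, p0] at h1
    have h2 : 0 ≤ c * (Q l A).toReal := by positivity
    linarith
  refine ⟨?_, ?_, ?_, ?_, floor⟩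
  · intro l hl ε₁ _ ε₂ _ h12
    simp only
    rw [attained (P l) (Q l) ε₂ _ rfl]
    refine lt_of_lt_of_le ?_ (val_le (P l) (Q l) ε₁
      {k | 0 < (Q l {k}).toReal - Real.exp ε₂ * (P l {k}).toReal})
    obtain ⟨k, hk⟩ := exists_nat_gt (l * Real.exp ε₂)
    have hpos : 0 < (P l {k | 0 < (Q l {k}).toReal - Real.exp ε₂ * (P l {k}).toReal}).toReal := by
      refine lt_of_lt_of_le (poisPMF_pos hl k) ?_
      rw [← pR l hl]
      apply ENNReal.toReal_mono (measure_ne_top _ _) (measure_mono _)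
      rw [Set.singleton_subset_iff]
      exact big l hl ε₂ k hk
    have := mul_lt_mul_of_pos_right (Real.exp_lt_exp.2 h12) hpos
    linarith
  · intro ε hε l₁ hl₁ l₂ hl₂ h12
    simp only [Set.mem_Ioi] at hl₁ hl₂ ⊢
    have hδ : 0 < privDelta (P l₁) (Q l₁) ε := by
      obtain ⟨k, hk⟩ := exists_nat_gt (l₁ * Real.exp ε)
      exact lt_of_lt_of_le (big l₁ hl₁ ε k hk) (val_le _ _ _ _)
    rw [attained (P l₂) (Q l₂) ε _ rfl]
    set S := {k | 0 < (Q l₂ {k}).toReal - Real.exp ε * (P l₂ {k}).toReal} with hS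
    obtain ⟨j, hj⟩ := exists_nat_gt (l₂ * Real.exp ε)
    have hjS : ∀ x, j + x ∈ S := by
      intro x
      apply big l₂ hl₂
      push_cast
      have : (0:ℝ) ≤ x := by positivity
      linarith
    obtain ⟨a, rfl⟩ : ∃ a : NNReal, (a : ℝ) = l₁ := ⟨⟨l₁, hl₁.le⟩, rfl⟩
    obtain ⟨b, rfl⟩ : ∃ b : NNReal, ((b + a : NNReal) : ℝ) = l₂ :=
      ⟨Real.toNNReal (l₂ - a), by
        rw [NNReal.coe_add, Real.coe_toNNReal _ (by linarith)]; ring⟩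
    have hb : 0 < b := by
      push_cast at h12
      exact_mod_cast (by linarith : (0:ℝ) < b)
    have eP1 := eq_poisson _ a (hP _ hl₁)
    have eP2 := eq_poisson _ (b + a) (hP _ hl₂)
    have eQ1 := eq_map _ _ _ (hP _ hl₁) (hQ _ hl₁)
    have eQ2 := eq_map _ _ _ (hP _ hl₂) (hQ _ hl₂)
    have hQS : Q ((b + a : NNReal) : ℝ) S
        = ProbabilityTheory.poissonMeasure (b + a) (Nat.succ ⁻¹' S) := by
      rw [eQ2, Measure.map_apply (by fun_prop) MeasurableSet.of_discrete, eP2]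
    obtain ⟨i1, s1⟩ := poisson_shift a b (Nat.succ ⁻¹' S)
    obtain ⟨i2, s2⟩ := poisson_shift a b S
    rw [hQS, eP2, s1, s2, ← integral_const_mul, ← integral_sub i1 (i2.const_mul _)]
    set R := ProbabilityTheory.poissonMeasure b with hR
    set D := privDelta (P a) (Q a) ε with hD
    have hval : ∀ y : ℕ, (ProbabilityTheory.poissonMeasure a
          ((fun x => y + x) ⁻¹' (Nat.succ ⁻¹' S))).toReal
        - Real.exp ε * (ProbabilityTheory.poissonMeasure a ((fun x => y + x) ⁻¹' S)).toReal
        = (Q a ((fun x => y + x) ⁻¹' S)).toReal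
          - Real.exp ε * (P a ((fun x => y + x) ⁻¹' S)).toReal := by
      intro y
      rw [eQ1, Measure.map_apply (by fun_prop) MeasurableSet.of_discrete, eP1]
      rfl
    simp_rw [hval]
    have iF : Integrable (fun y : ℕ => (Q a ((fun x => y + x) ⁻¹' S)).toReal
          - Real.exp ε * (P a ((fun x => y + x) ⁻¹' S)).toReal) R := by
      have := i1.sub (i2.const_mul (Real.exp ε))
      refine this.congr (Filter.Eventually.of_forall fun y => ?_)
      exact hval y
    have hconst : D = ∫ _ : ℕ, D ∂(R) := by simp
    rw [hconst, ← sub_pos, ← integral_sub (integrable_const _) iF]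
    refine (integral_pos_iff_support_of_nonneg ?_ ((integrable_const D).sub iF)).2 ?_
    swap
    · have hjR : 0 < R {j} := by
        have := ProbabilityTheory.poissonMeasure_real_singleton_pos j hb
        exact (ENNReal.toReal_pos_iff.1 this).1
      refine lt_of_lt_of_le hjR (measure_mono ?_)
      rw [Set.singleton_subset_iff, Function.mem_support]
      have : (fun x => j + x) ⁻¹' S = Set.univ := by
        ext x; simpa using hjS x
      simp only [Pi.sub_apply, this, measure_univ, ENNReal.toReal_one]
      have := Real.one_le_exp hε
      apply ne_of_gt
      linarith
    · intro y
      have := val_le (P a) (Q a) ε ((fun x => y + x) ⁻¹' S)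
      simp only [Pi.zero_apply, Pi.sub_apply]
      linarith
  · intro l hl ε₁ ε₂ h1 h12
    rw [attained (Q l) (P l) ε₂ _ rfl]
    set S := {k | 0 < (P l {k}).toReal - Real.exp ε₂ * (Q l {k}).toReal} with hS
    have hv := val_le (Q l) (P l) ε₁ S
    have he := Real.exp_lt_exp.2 h12
    have hq : 0 ≤ (Q l S).toReal := ENNReal.toReal_nonneg
    refine ⟨by nlinarith, fun h => ?_⟩
    by_cases hs : S ⊆ {0}
    · exact lt_of_le_of_lt (sub0 l hl S hs _ (Real.exp_pos _).le) h
    · obtain ⟨k, hkS, hk0⟩ := Set.not_subset.1 hs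
      obtain ⟨k, rfl⟩ := Nat.exists_eq_succ_of_ne_zero hk0
      have hpos : 0 < (Q l S).toReal := by
        refine lt_of_lt_of_le (poisPMF_pos hl k) ?_
        rw [← qR l hl]
        apply ENNReal.toReal_mono (measure_ne_top _ _) (measure_mono _)
        rw [Set.singleton_subset_iff]
        exact hkS
      nlinarith
  · intro l hl ε hε hle
    apply le_antisymm _ (floor l hl ε hε)
    rw [attained (Q l) (P l) ε _ rfl]
    apply sub0 l hl _ _ _ (Real.exp_pos _).le
    intro k hk
    by_contra hk0
    obtain ⟨k, rfl⟩ := Nat.exists_eq_succ_of_ne_zero hk0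
    simp only [Set.mem_ofPred_eq, Nat.succ_eq_add_one] at hk
    rw [pR l hl, qR l hl] at hk
    have h1 := poisPMF_succ l k
    have h2 := poisPMF_pos hl k
    have h3 := poisPMF_pos hl (k + 1)
    have h4 : (0:ℝ) ≤ k := by positivity
    have h5 := mul_nonneg h3.le h4
    have h6 := mul_le_mul_of_nonneg_right hle h2.le
    nlinarith
end

section
/- Let n ≥ 1, 0 ≤ k ≤ n−1, δ ∈ (0,1), and λ₀, λ₁ ≥ 0. Let P_n be the law of A − B where A ~ Binomial(n−k, δ) and B ~ Binomial(k, δ) are independent, and let P_∞ = Skellam(λ₀, λ₁). Let Q_n be the law of 1 + A′ − B′ where A′ ~ Binomial(n−k−1, δ) and B′ ~ Binomial(k+1, δ) are independent, and let Q_∞ be the law of 1 + D with D ~ Skellam(λ₀, λ₁). Then TV(P_n, P_∞) ≤ (n−k)δ(1−e^{−δ}) + kδ(1−e^{−δ}) + |(n−k)δ − λ₀| + |kδ − λ₁| ≤ nδ² + |(n−k)δ − λ₀| + |kδ − λ₁|, and TV(Q_n, Q_∞) ≤ nδ² + |(n−k−1)δ − λ₀| + |(k+1)δ − λ₁|. 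-/
open MeasureTheory Filter

/-- pmf on ℤ of the difference `X - Y` of independent ℕ-valued variables with pmfs `f`, `g`. -/
noncomputable def diffPMF (f g : ℕ → ℝ) (d : ℤ) : ℝ :=
  ∑' q : ℕ × ℕ, if (q.1 : ℤ) - (q.2 : ℤ) = d then f q.1 * g q.2 else 0

/-- Skellam(l0,l1) pmf on ℤ: law of `X - Y`, `X ~ Poi(l0)`, `Y ~ Poi(l1)` independent. -/
noncomputable def skellamPMF (l0 l1 : ℝ) (d : ℤ) : ℝ :=
  diffPMF (poisPMF l0) (poisPMF l1) d

/-- extended l1 distance -/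
noncomputable def L1d {α : Type*} (f g : α → ℝ) : ENNReal := ∑' n, ‖f n - g n‖ₑ

/-- push-forward of a product -/
noncomputable def pushP {γ : Type*} [DecidableEq γ] (φ : ℕ × ℕ → γ) (f g : ℕ → ℝ) (c : γ) : ℝ :=
  ∑' q : ℕ × ℕ, if φ q = c then f q.1 * g q.2 else 0

/-- probability mass function on ℕ -/
def IsP (f : ℕ → ℝ) : Prop := (∀ n, 0 ≤ f n) ∧ HasSum f 1

lemma L1d_triangle {α : Type*} (f g h : α → ℝ) : L1d f h ≤ L1d f g + L1d g h := by
  unfold L1d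
  rw [← ENNReal.tsum_add]
  refine ENNReal.tsum_le_tsum fun n => ?_
  have : f n - h n = (f n - g n) + (g n - h n) := by ring
  rw [this]
  exact enorm_add_le _ _

lemma L1d_symm {α : Type*} (f g : α → ℝ) : L1d f g = L1d g f := by
  unfold L1d
  refine tsum_congr fun n => ?_
  rw [← enorm_neg, neg_sub]

lemma L1d_self {α : Type*} (f : α → ℝ) : L1d f f = 0 := by
  simp [L1d]

lemma IsP.enorm {f : ℕ → ℝ} (hf : IsP f) : ∑' n, ‖f n‖ₑ = 1 := by
  have h := ENNReal.ofReal_tsum_of_nonneg hf.1 hf.2.summable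
  rw [hf.2.tsum_eq, ENNReal.ofReal_one] at h
  rw [h]
  exact tsum_congr fun n => Real.enorm_of_nonneg (hf.1 n)

lemma IsP.summable_mul {f g : ℕ → ℝ} (hf : IsP f) (hg : IsP g) :
    Summable fun q : ℕ × ℕ => f q.1 * g q.2 :=
  hf.2.summable.mul_of_nonneg hg.2.summable hf.1 hg.1

lemma L1d_push {γ : Type*} [DecidableEq γ] (φ : ℕ × ℕ → γ) {f g f' g' : ℕ → ℝ}
    (hf : IsP f) (hg : IsP g) (hf' : IsP f') (hg' : IsP g') :
    L1d (pushP φ f g) (pushP φ f' g') ≤ L1d f f' + L1d g g' := by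
  have key : ∀ c, ‖pushP φ f g c - pushP φ f' g' c‖ₑ ≤
      ∑' q : ℕ × ℕ, if φ q = c then ‖f q.1 * g q.2 - f' q.1 * g' q.2‖ₑ else 0 := by
    intro c
    have s1 : Summable fun q : ℕ × ℕ => if φ q = c then f q.1 * g q.2 else 0 := by
      classical
      refine ((hf.summable_mul hg).indicator {q | φ q = c}).congr fun q => ?_
      simp [Set.indicator_apply]
    have s2 : Summable fun q : ℕ × ℕ => if φ q = c then f' q.1 * g' q.2 else 0 := by
      classical
      refine ((hf'.summable_mul hg').indicator {q | φ q = c}).congr fun q => ?_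
      simp [Set.indicator_apply]
    unfold pushP
    rw [← s1.tsum_sub s2]
    refine (enorm_tsum_le_tsum_enorm).trans (le_of_eq (tsum_congr fun q => ?_))
    split_ifs <;> simp
  calc L1d (pushP φ f g) (pushP φ f' g')
      ≤ ∑' c, ∑' q : ℕ × ℕ, if φ q = c then ‖f q.1 * g q.2 - f' q.1 * g' q.2‖ₑ else 0 :=
        ENNReal.tsum_le_tsum key
    _ = ∑' q : ℕ × ℕ, ‖f q.1 * g q.2 - f' q.1 * g' q.2‖ₑ := by
        rw [ENNReal.tsum_comm]
        refine tsum_congr fun q => ?_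
        rw [tsum_eq_single (φ q)]
        · simp
        · intro c hc
          simp [hc.symm]
    _ ≤ ∑' q : ℕ × ℕ, (‖f q.1 - f' q.1‖ₑ * ‖g q.2‖ₑ + ‖f' q.1‖ₑ * ‖g q.2 - g' q.2‖ₑ) := by
        refine ENNReal.tsum_le_tsum fun q => ?_
        have : f q.1 * g q.2 - f' q.1 * g' q.2 =
          (f q.1 - f' q.1) * g q.2 + f' q.1 * (g q.2 - g' q.2) := by ring
        rw [this, ← enorm_mul, ← enorm_mul]
        exact enorm_add_le _ _
    _ = L1d f f' + L1d g g' := by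
        rw [ENNReal.tsum_add, ENNReal.tsum_prod', ENNReal.tsum_prod']
        simp only [ENNReal.tsum_mul_left, ENNReal.tsum_mul_right, hg.enorm, hf'.enorm, mul_one,
          one_mul]
        rfl

lemma push_add (f g : ℕ → ℝ) (n : ℕ) :
    pushP (fun q => q.1 + q.2) f g n = ∑ q ∈ Finset.HasAntidiagonal.antidiagonal n, f q.1 * g q.2 := by
  unfold pushP
  rw [tsum_eq_sum (s := Finset.HasAntidiagonal.antidiagonal n)]
  · refine Finset.sum_congr rfl fun q hq => ?_
    rw [Finset.HasAntidiagonal.mem_antidiagonal] at hq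
    simp [hq]
  · intro q hq
    rw [Finset.HasAntidiagonal.mem_antidiagonal] at hq
    simp [hq]

lemma isP_pois {l : ℝ} (hl : 0 ≤ l) : IsP (poisPMF l) :=
  ⟨fun n => by unfold poisPMF; positivity,
    ProbabilityTheory.hasSum_one_poissonMeasure ⟨l, hl⟩⟩

lemma isP_binom {p : ℝ} (h0 : 0 ≤ p) (h1 : p ≤ 1) (m : ℕ) : IsP (binomPMF m p) := by
  refine ⟨fun n => ?_, ?_⟩
  · unfold binomPMF
    have : 0 ≤ 1 - p := by linarith
    positivity
  · have h : ∑ i ∈ Finset.range (m + 1), binomPMF m p i = 1 := by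
      have := add_pow p (1 - p) m
      simp only [add_sub_cancel, one_pow] at this
      rw [this]
      refine Finset.sum_congr rfl fun i _ => ?_
      unfold binomPMF
      ring
    rw [← h]
    refine hasSum_sum_of_ne_finset_zero fun i hi => ?_
    have : m < i := by simpa using hi
    simp [binomPMF, Nat.choose_eq_zero_of_lt this]

lemma pois_add (a b : ℝ) :
    poisPMF (a + b) = pushP (fun q => q.1 + q.2) (poisPMF a) (poisPMF b) := by
  funext n
  rw [push_add]
  unfold poisPMF
  rw [(Commute.all a b).add_pow', Finset.mul_sum, Finset.sum_div]
  refine Finset.sum_congr rfl fun q hq => ?_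
  rw [Finset.HasAntidiagonal.mem_antidiagonal] at hq
  subst hq
  have h := Nat.add_choose_mul_factorial_mul_factorial q.1 q.2
  have h' : ((q.1 + q.2).choose q.1 : ℝ) * q.1.factorial * q.2.factorial
    = (q.1 + q.2).factorial := by
    rw [Nat.choose_symm_add]
    exact_mod_cast h
  rw [← h', neg_add, Real.exp_add, nsmul_eq_mul]
  have h1 : (q.1.factorial : ℝ) ≠ 0 := by positivity
  have h2 : (q.2.factorial : ℝ) ≠ 0 := by positivity
  have h3 : ((q.1 + q.2).choose q.1 : ℝ) ≠ 0 := by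
    have := Nat.choose_pos (Nat.le_add_right q.1 q.2)
    positivity
  field_simp

lemma binom_succ (p : ℝ) (m : ℕ) :
    binomPMF (m + 1) p = pushP (fun q => q.1 + q.2) (binomPMF m p) (binomPMF 1 p) := by
  have b0 : binomPMF 1 p 0 = 1 - p := by simp [binomPMF]
  have b1 : binomPMF 1 p 1 = p := by simp [binomPMF]
  have b2 : ∀ j, binomPMF 1 p (j + 2) = 0 := by
    intro j
    simp [binomPMF, Nat.choose_eq_zero_of_lt]
  funext n
  rw [push_add, Finset.Nat.sum_antidiagonal_eq_sum_range_succ_mk]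
  simp only
  rcases n with _ | n
  · simp [b0]
    simp [binomPMF]
    ring
  · rw [Finset.sum_range_succ, Finset.sum_range_succ, Finset.sum_eq_zero]
    · have : n + 1 - n = 1 := by omega
      rw [this, Nat.sub_self, b0, b1]
      unfold binomPMF
      rw [Nat.choose_succ_succ]
      have e : m + 1 - (n + 1) = m - n := by omega
      rw [e]
      push_cast
      rcases lt_or_ge n m with h | h
      · have e2 : m - n = (m - (n + 1)) + 1 := by omega
        rw [e2]
        ring
      · rw [Nat.choose_eq_zero_of_lt (by omega : m < n + 1)]
        push_cast
        ring
    · intro i hi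
      rw [Finset.mem_range] at hi
      obtain ⟨j, hj⟩ : ∃ j, n + 1 - i = j + 2 := ⟨n - 1 - i, by omega⟩
      rw [hj, b2, mul_zero]

lemma ennreal_split (k : ℕ) (f : ℕ → ENNReal) :
    ∑' n, f n = ∑ i ∈ Finset.range k, f i + ∑' n, f (n + k) :=
  (Summable.sum_add_tsum_nat_add' (f := f) (k := k) ENNReal.summable).symm

lemma L1d_bern {p : ℝ} (h0 : 0 ≤ p) :
    L1d (binomPMF 1 p) (poisPMF p) ≤ ENNReal.ofReal (2 * (p * (1 - Real.exp (-p)))) := by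
  have hexp : 1 - p ≤ Real.exp (-p) := by linarith [Real.add_one_le_exp (-p)]
  have he1 : Real.exp (-p) ≤ 1 := Real.exp_le_one_iff.2 (by linarith)
  have hP := isP_pois h0
  have hs : HasSum (fun j => poisPMF p (j + 2)) (1 - (Real.exp (-p) + Real.exp (-p) * p)) := by
    have := (hasSum_nat_add_iff' 2).2 hP.2
    simpa [Finset.sum_range_succ, poisPMF] using this
  have ht : ∑' j, ‖binomPMF 1 p (j + 2) - poisPMF p (j + 2)‖ₑ
      = ENNReal.ofReal (1 - (Real.exp (-p) + Real.exp (-p) * p)) := by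
    rw [← hs.tsum_eq, ENNReal.ofReal_tsum_of_nonneg (fun j => hP.1 _) hs.summable]
    refine tsum_congr fun j => ?_
    rw [← Real.enorm_of_nonneg (hP.1 _)]
    simp [binomPMF, Nat.choose_eq_zero_of_lt]
  have hn : 0 ≤ 1 - (Real.exp (-p) + Real.exp (-p) * p) := by
    rw [← hs.tsum_eq]
    exact tsum_nonneg fun j => hP.1 _
  unfold L1d
  rw [ennreal_split 2, ht]
  simp only [Finset.sum_range_succ, Finset.sum_range_zero, zero_add]
  have e0 : ‖binomPMF 1 p 0 - poisPMF p 0‖ₑ = ENNReal.ofReal (Real.exp (-p) - 1 + p) := by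
    rw [Real.enorm_eq_ofReal_abs, abs_sub_comm, abs_of_nonneg] <;> simp [binomPMF, poisPMF]
    · congr 1
      ring
    · linarith
  have e1 : ‖binomPMF 1 p 1 - poisPMF p 1‖ₑ = ENNReal.ofReal (p * (1 - Real.exp (-p))) := by
    rw [← Real.enorm_of_nonneg (mul_nonneg h0 (by linarith))]
    congr 1
    simp [binomPMF, poisPMF]
    ring
  rw [e0, e1, ← ENNReal.ofReal_add (by linarith) (mul_nonneg h0 (by linarith)),
    ← ENNReal.ofReal_add (add_nonneg (by linarith) (mul_nonneg h0 (by linarith))) hn]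
  apply ENNReal.ofReal_le_ofReal
  linarith

lemma L1d_pois_zero {h : ℝ} (h0 : 0 ≤ h) :
    L1d (poisPMF 0) (poisPMF h) ≤ ENNReal.ofReal (2 * h) := by
  have hexp : 1 - h ≤ Real.exp (-h) := by linarith [Real.add_one_le_exp (-h)]
  have he1 : Real.exp (-h) ≤ 1 := Real.exp_le_one_iff.2 (by linarith)
  have hP := isP_pois h0
  have hs : HasSum (fun j => poisPMF h (j + 1)) (1 - Real.exp (-h)) := by
    have := (hasSum_nat_add_iff' 1).2 hP.2
    simpa [Finset.sum_range_succ, poisPMF] using this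
  have ht : ∑' j, ‖poisPMF 0 (j + 1) - poisPMF h (j + 1)‖ₑ
      = ENNReal.ofReal (1 - Real.exp (-h)) := by
    rw [← hs.tsum_eq, ENNReal.ofReal_tsum_of_nonneg (fun j => hP.1 _) hs.summable]
    refine tsum_congr fun j => ?_
    rw [← Real.enorm_of_nonneg (hP.1 _)]
    simp [poisPMF]
  unfold L1d
  rw [ennreal_split 1, ht]
  simp only [Finset.sum_range_succ, Finset.sum_range_zero, zero_add]
  have e0 : ‖poisPMF 0 0 - poisPMF h 0‖ₑ = ENNReal.ofReal (1 - Real.exp (-h)) := by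
    rw [← Real.enorm_of_nonneg (by linarith)]
    simp [poisPMF]
  rw [e0, ← ENNReal.ofReal_add (by linarith) (by linarith)]
  apply ENNReal.ofReal_le_ofReal
  linarith

lemma L1d_pois_le {a b : ℝ} (ha : 0 ≤ a) (hab : a ≤ b) :
    L1d (poisPMF a) (poisPMF b) ≤ ENNReal.ofReal (2 * (b - a)) := by
  have e1 : poisPMF a = pushP (fun q => q.1 + q.2) (poisPMF a) (poisPMF 0) := by
    rw [← pois_add, add_zero]
  have e2 : poisPMF b = pushP (fun q => q.1 + q.2) (poisPMF a) (poisPMF (b - a)) := by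
    rw [← pois_add]
    congr 1
    ring
  have hb : 0 ≤ b - a := by linarith
  rw [e2]
  nth_rewrite 1 [e1]
  refine (L1d_push _ (isP_pois ha) (isP_pois le_rfl) (isP_pois ha) (isP_pois hb)).trans ?_
  rw [L1d_self, zero_add]
  exact L1d_pois_zero hb

lemma L1d_pois {a b : ℝ} (ha : 0 ≤ a) (hb : 0 ≤ b) :
    L1d (poisPMF a) (poisPMF b) ≤ ENNReal.ofReal (2 * |a - b|) := by
  rcases le_total a b with h | h
  · rw [abs_sub_comm, abs_of_nonneg (by linarith)]
    exact L1d_pois_le ha h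
  · rw [L1d_symm, abs_of_nonneg (by linarith)]
    exact L1d_pois_le hb h

lemma L1d_binom_pois {p : ℝ} (h0 : 0 ≤ p) (h1 : p ≤ 1) (m : ℕ) :
    L1d (binomPMF m p) (poisPMF (m * p)) ≤
      ENNReal.ofReal (2 * (m * p * (1 - Real.exp (-p)))) := by
  have he1 : Real.exp (-p) ≤ 1 := Real.exp_le_one_iff.2 (by linarith)
  have hc : 0 ≤ p * (1 - Real.exp (-p)) := mul_nonneg h0 (by linarith)
  induction m with
  | zero =>
    have : binomPMF 0 p = poisPMF ((0 : ℕ) * p) := by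
      funext n
      rcases n with _ | n <;> simp [binomPMF, poisPMF]
    rw [this, L1d_self]
    exact zero_le
  | succ m ih =>
    have e : poisPMF (((m + 1 : ℕ) : ℝ) * p) =
        pushP (fun q => q.1 + q.2) (poisPMF (m * p)) (poisPMF p) := by
      rw [← pois_add]
      congr 1
      push_cast
      ring
    rw [e, binom_succ]
    refine (L1d_push _ (isP_binom h0 h1 m) (isP_binom h0 h1 1) (isP_pois (by positivity))
      (isP_pois h0)).trans ?_
    refine (add_le_add ih (L1d_bern h0)).trans ?_
    have hm : 0 ≤ (m : ℝ) * p * (1 - Real.exp (-p)) := by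
      rw [mul_assoc]
      positivity
    rw [← ENNReal.ofReal_add (by positivity) (by positivity)]
    apply ENNReal.ofReal_le_ofReal
    push_cast
    linarith

lemma L1d_diff {p a b : ℝ} (h0 : 0 ≤ p) (h1 : p ≤ 1) (ha : 0 ≤ a) (hb : 0 ≤ b) (m k : ℕ) :
    L1d (diffPMF (binomPMF m p) (binomPMF k p)) (skellamPMF a b) ≤
      ENNReal.ofReal (2 * (m * p * (1 - Real.exp (-p)) + k * p * (1 - Real.exp (-p))
        + |m * p - a| + |k * p - b|)) := by
  have he1 : Real.exp (-p) ≤ 1 := Real.exp_le_one_iff.2 (by linarith)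
  have hq : 0 ≤ 1 - Real.exp (-p) := by linarith
  have H : ∀ (m : ℕ) (a : ℝ), 0 ≤ a → L1d (binomPMF m p) (poisPMF a) ≤
      ENNReal.ofReal (2 * (m * p * (1 - Real.exp (-p)) + |m * p - a|)) := by
    intro m a ha
    refine (L1d_triangle _ (poisPMF (m * p)) _).trans ?_
    refine (add_le_add (L1d_binom_pois h0 h1 m) (L1d_pois (by positivity) ha)).trans ?_
    rw [← ENNReal.ofReal_add (by positivity) (by positivity), mul_add]
  refine (L1d_push (fun q : ℕ × ℕ => (q.1 : ℤ) - (q.2 : ℤ)) (isP_binom h0 h1 m)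
    (isP_binom h0 h1 k) (isP_pois ha) (isP_pois hb)).trans ?_
  refine (add_le_add (H m a ha) (H k b hb)).trans ?_
  rw [← ENNReal.ofReal_add (by positivity) (by positivity)]
  apply ENNReal.ofReal_le_ofReal
  linarith

lemma meas_int (P : Measure ℤ) (A : Set ℤ) : P A = ∑' d, A.indicator (fun d => P {d}) d := by
  rw [← Measure.tsum_indicator_apply_singleton P A (MeasurableSet.of_discrete)]

lemma meas_le (P Q : Measure ℤ) (p q : ℤ → ℝ)
    (hp : ∀ d, P {d} = ENNReal.ofReal (p d)) (hq : ∀ d, Q {d} = ENNReal.ofReal (q d))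
    (A : Set ℤ) : P A ≤ Q A + ∑' d, A.indicator (fun d => ‖p d - q d‖ₑ) d := by
  rw [meas_int P A, meas_int Q A, ← ENNReal.tsum_add]
  refine ENNReal.tsum_le_tsum fun d => ?_
  by_cases h : d ∈ A
  · simp only [Set.indicator_of_mem h, hp, hq]
    rw [Real.enorm_eq_ofReal_abs]
    refine le_trans (ENNReal.ofReal_le_ofReal ?_) ENNReal.ofReal_add_le
    linarith [le_abs_self (p d - q d)]
  · simp [h]

lemma meas_sub_le (P Q : Measure ℤ) [IsProbabilityMeasure P] [IsProbabilityMeasure Q]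
    (p q : ℤ → ℝ)
    (hp : ∀ d, P {d} = ENNReal.ofReal (p d)) (hq : ∀ d, Q {d} = ENNReal.ofReal (q d))
    (R : ℝ) (hR : 0 ≤ R) (h : L1d p q ≤ ENNReal.ofReal (2 * R)) (A : Set ℤ) :
    (P A).toReal - (Q A).toReal ≤ R := by
  have h1 := meas_le P Q p q hp hq A
  have h2 := meas_le Q P q p hq hp Aᶜ
  have e : (∑' d, A.indicator (fun d => ‖p d - q d‖ₑ) d)
      + (∑' d, Aᶜ.indicator (fun d => ‖q d - p d‖ₑ) d) = L1d p q := by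
    rw [← ENNReal.tsum_add]
    refine tsum_congr fun d => ?_
    by_cases hd : d ∈ A
    · simp [hd]
    · simp only [Set.indicator_of_notMem hd, Set.indicator_of_mem (Set.mem_compl hd), zero_add]
      rw [← enorm_neg, neg_sub]
  have h3 : P A + Q Aᶜ ≤ (Q A + P Aᶜ) + ENNReal.ofReal (2 * R) := by
    refine (add_le_add h1 h2).trans ?_
    rw [add_add_add_comm, e]
    gcongr
  have h4 := ENNReal.toReal_mono (by finiteness) h3
  rw [ENNReal.toReal_add (by finiteness) (by finiteness),
    ENNReal.toReal_add (by finiteness) (by finiteness),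
    ENNReal.toReal_add (by finiteness) (by finiteness),
    ENNReal.toReal_ofReal (by positivity)] at h4
  have c1 := probReal_compl_eq_one_sub (μ := P) (s := A) MeasurableSet.of_discrete
  have c2 := probReal_compl_eq_one_sub (μ := Q) (s := A) MeasurableSet.of_discrete
  simp only [Measure.real] at c1 c2
  linarith

lemma tv_le (P Q : Measure ℤ) [IsProbabilityMeasure P] [IsProbabilityMeasure Q]
    (p q : ℤ → ℝ)
    (hp : ∀ d, P {d} = ENNReal.ofReal (p d)) (hq : ∀ d, Q {d} = ENNReal.ofReal (q d))
    (R : ℝ) (hR : 0 ≤ R) (h : L1d p q ≤ ENNReal.ofReal (2 * R)) : tvDist P Q ≤ R := by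
  unfold tvDist
  have : Nonempty {s : Set ℤ // MeasurableSet s} := ⟨⟨∅, MeasurableSet.empty⟩⟩
  refine ciSup_le fun A => ?_
  rw [abs_le]
  have h1 := meas_sub_le P Q p q hp hq R hR h A.1
  have h2 := meas_sub_le Q P q p hq hp R hR (by rwa [L1d_symm]) A.1
  constructor <;> linarith

/-- Skellam-shift limit: explicit TV bounds between the centered binomial-difference laws
`P_n = law(Bin(n-k,δ) - Bin(k,δ))`, `Q_n = law(1 + Bin(n-k-1,δ) - Bin(k+1,δ))` and the
Skellam-shift pair `P_∞ = Skellam(λ₀,λ₁)`, `Q_∞ = law(1 + Skellam(λ₀,λ₁))`. -/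
theorem stmt8 (n k : ℕ) (hn : 1 ≤ n) (hk : k ≤ n - 1)
    (δ l0 l1 : ℝ) (hδ0 : 0 < δ) (hδ1 : δ < 1) (hl0 : 0 ≤ l0) (hl1 : 0 ≤ l1)
    (Pn Pinf Qn Qinf : Measure ℤ)
    [IsProbabilityMeasure Pn] [IsProbabilityMeasure Pinf]
    [IsProbabilityMeasure Qn] [IsProbabilityMeasure Qinf]
    (hPn : ∀ d : ℤ, Pn {d} = ENNReal.ofReal (diffPMF (binomPMF (n - k) δ) (binomPMF k δ) d))
    (hPinf : ∀ d : ℤ, Pinf {d} = ENNReal.ofReal (skellamPMF l0 l1 d))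
    (hQn : ∀ d : ℤ, Qn {d} = ENNReal.ofReal
      (diffPMF (binomPMF (n - k - 1) δ) (binomPMF (k + 1) δ) (d - 1)))
    (hQinf : ∀ d : ℤ, Qinf {d} = ENNReal.ofReal (skellamPMF l0 l1 (d - 1))) :
    tvDist Pn Pinf
      ≤ ((n : ℝ) - k) * δ * (1 - Real.exp (-δ)) + (k : ℝ) * δ * (1 - Real.exp (-δ))
        + |((n : ℝ) - k) * δ - l0| + |(k : ℝ) * δ - l1|
    ∧ ((n : ℝ) - k) * δ * (1 - Real.exp (-δ)) + (k : ℝ) * δ * (1 - Real.exp (-δ))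
        + |((n : ℝ) - k) * δ - l0| + |(k : ℝ) * δ - l1|
      ≤ (n : ℝ) * δ ^ 2 + |((n : ℝ) - k) * δ - l0| + |(k : ℝ) * δ - l1|
    ∧ tvDist Qn Qinf
      ≤ (n : ℝ) * δ ^ 2 + |((n : ℝ) - k - 1) * δ - l0| + |((k : ℝ) + 1) * δ - l1| := by
  have he1 : Real.exp (-δ) ≤ 1 := Real.exp_le_one_iff.2 (by linarith)
  have hq : 0 ≤ 1 - Real.exp (-δ) := by linarith
  have hq2 : 1 - Real.exp (-δ) ≤ δ := by linarith [Real.add_one_le_exp (-δ)]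
  have hfin : (n : ℝ) * (δ * (1 - Real.exp (-δ))) ≤ n * δ ^ 2 := by
    rw [pow_two]
    gcongr
  have hkn : k ≤ n := by omega
  have c1 : ((n - k : ℕ) : ℝ) = (n : ℝ) - k := Nat.cast_sub hkn
  have c2 : ((n - k - 1 : ℕ) : ℝ) = (n : ℝ) - k - 1 := by
    rw [Nat.cast_sub (by omega), c1, Nat.cast_one]
  have c3 : ((k + 1 : ℕ) : ℝ) = (k : ℝ) + 1 := by push_cast; ring
  refine ⟨?_, by linarith, ?_⟩
  · have h := L1d_diff hδ0.le hδ1.le hl0 hl1 (n - k) k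
    rw [← c1]
    exact tv_le Pn Pinf _ _ hPn hPinf _ (by positivity) h
  · have h := L1d_diff hδ0.le hδ1.le hl0 hl1 (n - k - 1) (k + 1)
    have h' : L1d (fun d : ℤ => diffPMF (binomPMF (n - k - 1) δ) (binomPMF (k + 1) δ) (d - 1))
        (fun d : ℤ => skellamPMF l0 l1 (d - 1)) =
        L1d (diffPMF (binomPMF (n - k - 1) δ) (binomPMF (k + 1) δ)) (skellamPMF l0 l1) :=
      (Equiv.subRight (1 : ℤ)).tsum_eq (fun d =>
        ‖diffPMF (binomPMF (n - k - 1) δ) (binomPMF (k + 1) δ) d - skellamPMF l0 l1 d‖ₑ)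
    rw [← h'] at h
    refine (tv_le Qn Qinf _ _ hQn hQinf _ (by positivity) h).trans ?_
    rw [c2, c3]
    linarith
end

section
/- Fix π ∈ (0,1). For t > 0, let D_t ~ Skellam((1−π)t, πt), let P_t be the law of D_t, and let Q_t be the law of 1 + D_t. Then for all ε ≥ 0 and all t₁ > t₂ > 0 (equivalently, parameterizing t = c^{−2}, for all 0 < c₁ < c₂): δ_{Q_{t₁}‖P_{t₁}}(ε) ≤ δ_{Q_{t₂}‖P_{t₂}}(ε) and δ_{P_{t₁}‖Q_{t₁}}(ε) ≤ δ_{P_{t₂}‖Q_{t₂}}(ε). Consequently, the two-sided curve max{δ_{Q_t‖P_t}(ε), δ_{P_t‖Q_t}(ε)} is monotone: adding Poisson intensity (smaller c, more noise) improves privacy. -/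
open MeasureTheory Filter

open ProbabilityTheory in
/-- Skellam law as a convolution of measures. -/
noncomputable def skMeas (a b : NNReal) : Measure ℤ :=
  Measure.conv ((poissonMeasure a).map (Nat.cast : ℕ → ℤ))
    (((poissonMeasure b).map (Nat.cast : ℕ → ℤ)).map (fun z => -z))

instance skMeas_prob (a b : NNReal) : IsProbabilityMeasure (skMeas a b) := by
  unfold skMeas
  haveI : IsProbabilityMeasure
      (((ProbabilityTheory.poissonMeasure b).map (Nat.cast : ℕ → ℤ)).map (fun z => -z)) :=
    Measure.isProbabilityMeasure_map .of_discrete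
  infer_instance

open ProbabilityTheory in
lemma skMeas_conv (a b c d : NNReal) :
    Measure.conv (skMeas a b) (skMeas c d) = skMeas (a + c) (b + d) := by
  unfold skMeas
  have hneg : ∀ b : NNReal, IsProbabilityMeasure
      (((poissonMeasure b).map (Nat.cast : ℕ → ℤ)).map (fun z => -z)) :=
    fun b => Measure.isProbabilityMeasure_map .of_discrete
  have h2 : Measure.conv (((poissonMeasure b).map (Nat.cast : ℕ → ℤ)).map (fun z => -z))
      (((poissonMeasure d).map (Nat.cast : ℕ → ℤ)).map (fun z => -z)) =
      (((poissonMeasure (b + d)).map (Nat.cast : ℕ → ℤ)).map (fun z => -z)) := by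
    rw [← map_cast_poissonMeasure_conv]
    exact (Measure.map_conv_addMonoidHom (negAddMonoidHom (α := ℤ)) .of_discrete).symm
  rw [← h2, ← map_cast_poissonMeasure_conv]
  rw [Measure.conv_assoc, Measure.conv_assoc]
  congr 1
  rw [← Measure.conv_assoc, ← Measure.conv_assoc]
  congr 1
  rw [Measure.conv_comm]

open ProbabilityTheory in
lemma skMeas_singleton (a b : NNReal) (d : ℤ) :
    skMeas a b {d} = ENNReal.ofReal (skellamPMF a b d) := by
  have h1 : skMeas a b = ((poissonMeasure a).prod (poissonMeasure b)).map
      (fun q : ℕ × ℕ => (q.1 : ℤ) - (q.2 : ℤ)) := by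
    unfold skMeas
    rw [Measure.map_map .of_discrete .of_discrete, Measure.conv,
      Measure.map_prod_map _ _ .of_discrete .of_discrete,
      Measure.map_map .of_discrete .of_discrete]
    congr 1
  have hnn : ∀ (l : NNReal) (k : ℕ), 0 ≤ poisPMF l k := by
    intro l k; unfold poisPMF; positivity
  have hsum : ∀ l : NNReal, Summable (poisPMF l) := fun l => (hasSum_one_poissonMeasure l).summable
  have hS : Summable (fun q : ℕ × ℕ => poisPMF a q.1 * poisPMF b q.2) :=
    (hsum a).mul_of_nonneg (hsum b) (hnn a) (hnn b)
  have hS2 : Summable (fun q : ℕ × ℕ =>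
      if (q.1 : ℤ) - (q.2 : ℤ) = d then poisPMF a q.1 * poisPMF b q.2 else 0) := by
    refine Summable.of_nonneg_of_le (fun q => ?_) (fun q => ?_) hS
    · split_ifs
      · exact mul_nonneg (hnn _ _) (hnn _ _)
      · exact le_rfl
    · split_ifs
      · exact le_rfl
      · exact mul_nonneg (hnn _ _) (hnn _ _)
  rw [h1, Measure.map_apply .of_discrete (measurableSet_singleton d),
    ← Measure.tsum_indicator_apply_singleton _ _ .of_discrete]
  unfold skellamPMF diffPMF
  rw [ENNReal.ofReal_tsum_of_nonneg _ hS2]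
  · refine tsum_congr fun q => ?_
    obtain ⟨m, n⟩ := q
    by_cases h : (m : ℤ) - (n : ℤ) = d
    · rw [Set.indicator_of_mem (by simpa using h)]
      simp only [h, if_true]
      rw [← Set.singleton_prod_singleton, Measure.prod_prod, poissonMeasure_singleton,
        poissonMeasure_singleton, ENNReal.ofReal_mul (hnn _ _)]
      rfl
    · rw [Set.indicator_of_notMem (by simpa using h)]
      simp [h]
  · intro q
    split_ifs
    · exact mul_nonneg (hnn _ _) (hnn _ _)
    · exact le_rfl

lemma privDelta_bdd (P Q : Measure ℤ) [IsProbabilityMeasure P] [IsProbabilityMeasure Q] (ε : ℝ) :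
    BddAbove (Set.range fun A : {s : Set ℤ // MeasurableSet s} =>
      ((Q A.1).toReal - Real.exp ε * (P A.1).toReal)) := by
  refine ⟨1, ?_⟩
  rintro _ ⟨A, rfl⟩
  have h1 : (Q A.1).toReal ≤ 1 := measureReal_le_one
  have h2 : 0 ≤ Real.exp ε * (P A.1).toReal := by positivity
  simp only
  linarith

lemma conv_toReal (μ ν : Measure ℤ) [IsProbabilityMeasure μ] [IsProbabilityMeasure ν]
    (A : Set ℤ) :
    Integrable (fun y => (μ ((fun x => x + y) ⁻¹' A)).toReal) ν ∧
    (Measure.conv μ ν A).toReal = ∫ y, (μ ((fun x => x + y) ⁻¹' A)).toReal ∂ν := by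
  have hI : Integrable (fun y => (μ ((fun x => x + y) ⁻¹' A)).toReal) ν := by
    refine Integrable.of_bound (C := 1) (Measurable.of_discrete.aestronglyMeasurable)
      (Eventually.of_forall fun y => ?_)
    rw [Real.norm_of_nonneg ENNReal.toReal_nonneg]
    exact measureReal_le_one
  refine ⟨hI, ?_⟩
  rw [integral_toReal Measurable.of_discrete.aemeasurable
    (Eventually.of_forall fun y => measure_lt_top _ _)]
  congr 1
  rw [Measure.conv, Measure.map_apply .of_discrete .of_discrete,
    Measure.prod_apply_symm .of_discrete]
  rfl

/-- Data processing for convolution. -/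
lemma privDelta_conv_le (P Q ν : Measure ℤ) [IsProbabilityMeasure P] [IsProbabilityMeasure Q]
    [IsProbabilityMeasure ν] (ε : ℝ) :
    privDelta (Measure.conv P ν) (Measure.conv Q ν) ε ≤ privDelta P Q ε := by
  haveI : Nonempty {s : Set ℤ // MeasurableSet s} := ⟨⟨∅, .empty⟩⟩
  refine ciSup_le fun A => ?_
  obtain ⟨iP, eP⟩ := conv_toReal P ν A.1
  obtain ⟨iQ, eQ⟩ := conv_toReal Q ν A.1
  rw [eP, eQ, ← integral_const_mul, ← integral_sub iQ (iP.const_mul _)]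
  calc _ ≤ ∫ _y, privDelta P Q ε ∂ν := by
        refine integral_mono (iQ.sub (iP.const_mul _)) (integrable_const _) fun y => ?_
        exact le_ciSup (privDelta_bdd P Q ε) ⟨(fun x => x + y) ⁻¹' A.1, .of_discrete⟩
    _ = privDelta P Q ε := by simp

/-- Monotonicity in the signal-to-noise parameter for the Skellam-shift limiting curves:
for `P_t = Skellam((1-π)t, πt)` and `Q_t = law(1 + Skellam((1-π)t, πt))`, both one-sided
privacy curves, and hence the two-sided curve, are monotone: `t₁ > t₂` gives smaller δ. -/
theorem stmt12 (p : ℝ) (hp0 : 0 < p) (hp1 : p < 1)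
    (P Q : ℝ → Measure ℤ)
    [∀ t, IsProbabilityMeasure (P t)] [∀ t, IsProbabilityMeasure (Q t)]
    (hP : ∀ t : ℝ, 0 < t → ∀ d, P t {d} = ENNReal.ofReal (skellamPMF ((1 - p) * t) (p * t) d))
    (hQ : ∀ t : ℝ, 0 < t → ∀ d,
      Q t {d} = ENNReal.ofReal (skellamPMF ((1 - p) * t) (p * t) (d - 1))) :
    ∀ ε : ℝ, 0 ≤ ε → ∀ t₁ t₂ : ℝ, 0 < t₂ → t₂ < t₁ →
      privDelta (P t₁) (Q t₁) ε ≤ privDelta (P t₂) (Q t₂) ε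
      ∧ privDelta (Q t₁) (P t₁) ε ≤ privDelta (Q t₂) (P t₂) ε
      ∧ max (privDelta (P t₁) (Q t₁) ε) (privDelta (Q t₁) (P t₁) ε)
          ≤ max (privDelta (P t₂) (Q t₂) ε) (privDelta (Q t₂) (P t₂) ε) := by
  intro ε _ t₁ t₂ h2 h12
  have hq : 0 < 1 - p := by linarith
  have key : ∀ t : ℝ, 0 < t → P t = skMeas ((1 - p) * t).toNNReal (p * t).toNNReal := by
    intro t ht
    refine Measure.ext_of_singleton fun d => ?_
    rw [hP t ht, skMeas_singleton, Real.coe_toNNReal _ (by positivity),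
      Real.coe_toNNReal _ (by positivity)]
  have keyQ : ∀ t : ℝ, 0 < t → Q t = Measure.conv (Measure.dirac 1) (P t) := by
    intro t ht
    refine Measure.ext_of_singleton fun d => ?_
    rw [Measure.dirac_conv, Measure.map_apply .of_discrete .of_discrete, hQ t ht,
      ← hP t ht]
    congr 1
    ext x
    simp only [Set.mem_singleton_iff, Set.mem_preimage]
    omega
  have ht1 : 0 < t₁ := h2.trans h12
  have hs : 0 < t₁ - t₂ := by linarith
  have eP : P t₁ = Measure.conv (P t₂) (P (t₁ - t₂)) := by
    rw [key _ ht1, key _ h2, key _ hs, skMeas_conv,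
      ← Real.toNNReal_add (by positivity) (by positivity),
      ← Real.toNNReal_add (by positivity) (by positivity)]
    congr 2 <;> ring
  have eQ : Q t₁ = Measure.conv (Q t₂) (P (t₁ - t₂)) := by
    rw [keyQ _ ht1, keyQ _ h2, eP, Measure.conv_assoc]
  have a1 : privDelta (P t₁) (Q t₁) ε ≤ privDelta (P t₂) (Q t₂) ε := by
    rw [eP, eQ]
    exact privDelta_conv_le _ _ _ _
  have a2 : privDelta (Q t₁) (P t₁) ε ≤ privDelta (Q t₂) (P t₂) ε := by
    rw [eP, eQ]
    exact privDelta_conv_le _ _ _ _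
  exact ⟨a1, a2, max_le_max a1 a2⟩
end
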